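/- Assume in addition that g(t) = 1 for all t ∈ [0, a/2]. Then β_{a/2} = λ₁ and u_{a/2} = (a/(2 v₁(0))) v₁, and consequently ∫_Ω |∇u_γ|² dy → 4π + a² λ₁ / (4 v₁(0)²) as γ → +∞. -/

import Mathlib

open Real Set Filter MeasureTheory Topology

noncomputable section

/-- The radial Laplacian with the sign convention Δ = −div(∇·):
for a radial C² function, (Δu)(r) = −u''(r) − u'(r)/r. -/
def radLap (u : ℝ → ℝ) (r : ℝ) : ℝ := -(deriv (deriv u) r) - deriv u r / r

/-- `GCtx a c0 g` : a > 0, c₀ > 0, g is continuous and positive on [0,∞), and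
g(t) = exp(t² − at) for all t ≥ c₀ (hypotheses (G1)-(G2) of the paper). -/
def GCtx (a c0 : ℝ) (g : ℝ → ℝ) : Prop :=
  0 < a ∧ 0 < c0 ∧ ContinuousOn g (Set.Ici 0) ∧ (∀ t : ℝ, 0 ≤ t → 0 < g t) ∧
    ∀ t : ℝ, c0 ≤ t → g t = Real.exp (t ^ 2 - a * t)

/-- `IsGSol g beta gam u` : u is a smooth radial function on the closed unit disk,
positive in the open disk, vanishing on the boundary, with central value γ, solving
Δu = β u g(u) in Ω (radially). -/
def IsGSol (g : ℝ → ℝ) (beta gam : ℝ) (u : ℝ → ℝ) : Prop :=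
  ContDiffOn ℝ (⊤ : ℕ∞) u (Set.Icc 0 1) ∧
    (∀ r ∈ Set.Ioo (0:ℝ) 1, radLap u r = beta * u r * g (u r)) ∧
    (∀ r ∈ Set.Ico (0:ℝ) 1, 0 < u r) ∧ u 1 = 0 ∧ u 0 = gam

/-- Dirichlet energy ∫_Ω |∇u|² dy of a radial function, = ∫₀¹ u'(r)² 2πr dr. -/
def dirEnergy (u : ℝ → ℝ) : ℝ := ∫ r in Set.Ioo (0:ℝ) 1, (deriv u r) ^ 2 * (2 * π * r)

/-- `EigenCtx lam1 v1` : λ₁ > 0 is the first radial Dirichlet eigenvalue of Δ = −div∇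
on the unit disk, with radial eigenfunction v₁: v₁ smooth on [0,1], Δv₁ = λ₁v₁ in Ω,
v₁ > 0 in Ω, v₁(1) = 0 and ∫_Ω v₁² dy = ∫₀¹ v₁(r)² 2πr dr = 1. -/
def EigenCtx (lam1 : ℝ) (v1 : ℝ → ℝ) : Prop :=
  0 < lam1 ∧ ContDiffOn ℝ (⊤ : ℕ∞) v1 (Set.Icc 0 1) ∧
    (∀ r ∈ Set.Ioo (0:ℝ) 1, radLap v1 r = lam1 * v1 r) ∧
    (∀ r ∈ Set.Ico (0:ℝ) 1, 0 < v1 r) ∧ v1 1 = 0 ∧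
    (∫ r in Set.Ioo (0:ℝ) 1, (v1 r) ^ 2 * (2 * π * r)) = 1

/-- A function with nonnegative derivative on a closed interval increases between the endpoints. -/
lemma le_of_hasDerivAt_nonneg {f f' : ℝ → ℝ} {a b : ℝ} (hab : a ≤ b)
    (h : ∀ t ∈ Icc a b, HasDerivAt f (f' t) t) (h0 : ∀ t ∈ Icc a b, 0 ≤ f' t) : f a ≤ f b := by
  have hm : MonotoneOn f (Icc a b) := by
    apply monotoneOn_of_deriv_nonneg (convex_Icc a b)
    · exact fun t ht => (h t ht).continuousAt.continuousWithinAt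
    · exact fun t ht => (h t (interior_subset ht)).differentiableAt.differentiableWithinAt
    · intro t ht
      rw [(h t (interior_subset ht)).deriv]
      exact h0 t (interior_subset ht)
  exact hm (left_mem_Icc.2 hab) (right_mem_Icc.2 hab) hab

/-- A function with nonnegative derivative on a half-line lies below its limit at infinity. -/
lemma le_of_hasDerivAt_nonneg_of_tendsto {f f' : ℝ → ℝ} {s L : ℝ}
    (h : ∀ t, s ≤ t → HasDerivAt f (f' t) t) (h0 : ∀ t, s ≤ t → 0 ≤ f' t)
    (hL : Tendsto f atTop (𝓝 L)) : f s ≤ L := by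
  refine ge_of_tendsto hL ?_
  filter_upwards [eventually_ge_atTop s] with t ht
  exact le_of_hasDerivAt_nonneg ht (fun r hr => h r hr.1) (fun r hr => h0 r hr.1)

/-- If `|f'| ≤ -k'` on an interval then the oscillation of `f` is controlled by that of `k`. -/
lemma abs_sub_le_of_abs_deriv_le {f f' k k' : ℝ → ℝ} {a b : ℝ} (hab : a ≤ b)
    (hf : ∀ t ∈ Icc a b, HasDerivAt f (f' t) t) (hk : ∀ t ∈ Icc a b, HasDerivAt k (k' t) t)
    (h : ∀ t ∈ Icc a b, |f' t| ≤ -k' t) : |f a - f b| ≤ k a - k b := by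
  have h1 := le_of_hasDerivAt_nonneg (f := fun t => f t - k t) hab
    (fun t ht => (hf t ht).sub (hk t ht)) (fun t ht => by have := (abs_le.1 (h t ht)).1; linarith)
  have h2 := le_of_hasDerivAt_nonneg (f := fun t => -f t - k t) hab
    (fun t ht => (hf t ht).neg.sub (hk t ht)) (fun t ht => by
      have := (abs_le.1 (h t ht)).2; linarith)
  rw [abs_le]; constructor <;> linarith

/-- A positive radial solution of `Δu = β u g(u)` on the unit disk, in the logarithmic variable
`s = -log (√β r)`: `W = u`, `p = -r u'`, and `A` is the energy contained in the disk of radius `r`,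
with total amount `E`. -/
structure LogSol (g : ℝ → ℝ) (s0 γ : ℝ) (W p A : ℝ → ℝ) (E : ℝ) : Prop where
  hW : ∀ s, s0 < s → HasDerivAt W (p s) s
  hp : ∀ s, s0 < s → HasDerivAt p (-(exp (-2 * s) * (W s * g (W s)))) s
  hA : ∀ s, s0 < s → HasDerivAt A (-(exp (-2 * s) * (W s * g (W s)) * W s)) s
  pos : ∀ s, s0 < s → 0 < W s
  gpos : ∀ s, s0 < s → 0 < g (W s)
  W_top : Tendsto W atTop (𝓝 γ)
  p_top : Tendsto p atTop (𝓝 0)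
  A_top : Tendsto A atTop (𝓝 0)
  W_bot : Tendsto W (𝓝[>] s0) (𝓝 0)
  A_bot : Tendsto A (𝓝[>] s0) (𝓝 E)

namespace LogSol

variable {g : ℝ → ℝ} {s0 γ : ℝ} {W p A : ℝ → ℝ} {E : ℝ}

lemma source_pos (S : LogSol g s0 γ W p A E) {s : ℝ} (hs : s0 < s) :
    0 < exp (-2 * s) * (W s * g (W s)) :=
  mul_pos (exp_pos _) (mul_pos (S.pos s hs) (S.gpos s hs))

lemma p_anti (S : LogSol g s0 γ W p A E) {s t : ℝ} (hs : s0 < s) (hst : s ≤ t) : p t ≤ p s := by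
  have := le_of_hasDerivAt_nonneg (f := fun t => -p t) hst
    (fun r hr => (S.hp r (hs.trans_le hr.1)).neg)
    (fun r hr => by have := S.source_pos (hs.trans_le hr.1); linarith)
  simpa using this

lemma p_pos (S : LogSol g s0 γ W p A E) {s : ℝ} (hs : s0 < s) : 0 < p s := by
  have h1 : StrictAntiOn p (Ioi s0) := by
    apply strictAntiOn_of_deriv_neg (convex_Ioi s0)
    · exact fun t ht => (S.hp t ht).continuousAt.continuousWithinAt
    · intro t ht
      rw [interior_Ioi] at ht
      rw [(S.hp t ht).deriv]
      have := S.source_pos ht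
      linarith
  have h2 : p (s + 1) < p s := h1 hs (show s0 < s + 1 by linarith) (by linarith)
  have h3 : 0 ≤ p (s + 1) := by
    refine le_of_tendsto S.p_top ?_
    filter_upwards [eventually_ge_atTop (s + 1)] with t ht
    exact S.p_anti (by linarith) ht
  linarith

lemma W_mono (S : LogSol g s0 γ W p A E) {s t : ℝ} (hs : s0 < s) (hst : s ≤ t) : W s ≤ W t :=
  le_of_hasDerivAt_nonneg hst (fun r hr => S.hW r (hs.trans_le hr.1))
    (fun _ hr => (S.p_pos (hs.trans_le hr.1)).le)

lemma W_le (S : LogSol g s0 γ W p A E) {s : ℝ} (hs : s0 < s) : W s ≤ γ :=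
  le_of_hasDerivAt_nonneg_of_tendsto (fun r hr => S.hW r (hs.trans_le hr))
    (fun _ hr => (S.p_pos (hs.trans_le hr)).le) S.W_top

lemma A_anti (S : LogSol g s0 γ W p A E) {s t : ℝ} (hs : s0 < s) (hst : s ≤ t) : A t ≤ A s := by
  have := le_of_hasDerivAt_nonneg (f := fun t => -A t) hst
    (fun r hr => (S.hA r (hs.trans_le hr.1)).neg)
    (fun r hr => by
      have := mul_pos (S.source_pos (hs.trans_le hr.1)) (S.pos r (hs.trans_le hr.1)); linarith)
  simpa using this

lemma W_le_tangent (S : LogSol g s0 γ W p A E) {s t : ℝ} (hs : s0 < s) (hst : s ≤ t) :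
    p t * (t - s) ≤ W t - W s := by
  have := le_of_hasDerivAt_nonneg (f := fun r => W r - p t * r) hst
    (fun r hr => (S.hW r (hs.trans_le hr.1)).sub ((hasDerivAt_id r).const_mul (p t)))
    (fun r hr => by have := S.p_anti (hs.trans_le hr.1) hr.2; linarith)
  linarith

lemma tangent_le_W (S : LogSol g s0 γ W p A E) {s t : ℝ} (hs : s0 < s) (hst : s ≤ t) :
    W t - W s ≤ p s * (t - s) := by
  have := le_of_hasDerivAt_nonneg (f := fun r => p s * r - W r) hst
    (fun r hr => ((hasDerivAt_id r).const_mul (p s)).sub (S.hW r (hs.trans_le hr.1)))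
    (fun r hr => by have := S.p_anti hs hr.1; linarith)
  linarith

lemma A_le (S : LogSol g s0 γ W p A E) {s : ℝ} (hs : s0 < s) : A s ≤ γ * p s := by
  have := le_of_hasDerivAt_nonneg_of_tendsto (f := fun r => A r - γ * p r) (L := 0 - γ * 0)
    (fun r hr => (S.hA r (hs.trans_le hr)).sub ((S.hp r (hs.trans_le hr)).const_mul γ))
    (fun r hr => by
      nlinarith [mul_nonneg (S.source_pos (hs.trans_le hr)).le
        (sub_nonneg.2 (S.W_le (hs.trans_le hr)))])
    (S.A_top.sub (S.p_top.const_mul γ))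
  linarith

lemma le_A (S : LogSol g s0 γ W p A E) {s : ℝ} (hs : s0 < s) : W s * p s ≤ A s := by
  have := le_of_hasDerivAt_nonneg_of_tendsto (f := fun r => W r * p r - A r) (L := γ * 0 - 0)
    (fun r hr => ((S.hW r (hs.trans_le hr)).mul (S.hp r (hs.trans_le hr))).sub
      (S.hA r (hs.trans_le hr)))
    (fun r hr => by nlinarith [mul_self_nonneg (p r)])
    ((S.W_top.mul S.p_top).sub S.A_top)
  linarith

/-- Every height strictly between `0` and the value at some point is attained before it. -/
lemma exists_height (S : LogSol g s0 γ W p A E) {h t : ℝ} (h0 : 0 < h) (ht : s0 < t)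
    (hh : h ≤ W t) : ∃ s, s0 < s ∧ s ≤ t ∧ W s = h := by
  have h1 : ∀ᶠ s in 𝓝[>] s0, W s < h := S.W_bot.eventually (gt_mem_nhds h0)
  have h2 : ∀ᶠ s in 𝓝[>] s0, s ∈ Ioo s0 t := Ioo_mem_nhdsGT ht
  obtain ⟨s, hs1, hs2⟩ := (h1.and h2).exists
  have hc : ContinuousOn W (Icc s t) := fun r hr =>
    (S.hW r (hs2.1.trans_le hr.1)).continuousAt.continuousWithinAt
  obtain ⟨r, hr, hr2⟩ := intermediate_value_Icc hs2.2.le hc ⟨hs1.le, hh⟩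
  exact ⟨r, hs2.1.trans_le hr.1, hr.2, hr2⟩

end LogSol

set_option maxHeartbeats 1000000 in
/-- The core of the analysis of the concentration peak: estimates at a point `s` whose height is
`γ - 1/x`, where `γ = x²`. -/
lemma peak_estimates {W p : ℝ → ℝ} {a x s : ℝ} (ha : 0 < a) (hx : 8 ≤ x)
    (hax : a + 1 / a + 3 ≤ x ^ 2 / 2) (hex : 2 * exp (-(x / 2)) ≤ 1 / x ^ 3)
    (hW : ∀ t, s ≤ t → HasDerivAt W (p t) t)
    (hp : ∀ t, s ≤ t → HasDerivAt p (-(W t * exp (-2 * t + W t ^ 2 - a * W t))) t)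
    (W_top : Tendsto W atTop (𝓝 (x ^ 2))) (p_top : Tendsto p atTop (𝓝 0))
    (hpos : ∀ t, s ≤ t → 0 < p t) (hWs : W s = x ^ 2 - 1 / x) :
    x ^ 2 - a / 2 - 1 / x ≤ 2 / p s ∧ 2 / p s ≤ x ^ 2 - a / 2 + 6 / x ∧
      W s * exp (-2 * s + W s ^ 2 - a * W s) ≤ p s * (6 / x ^ 3) ∧
      exp (-x) / (2 * x ^ 2) ≤ W s * exp (-2 * s + W s ^ 2 - a * W s) := by
  have hx0 : 0 < x := by linarith
  have ha1 : 0 < 1 / a := by positivity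
  have hx1 : 1 / x ≤ 1 / 8 := one_div_le_one_div_of_le (by norm_num) hx
  have hx1' : 0 < 1 / x := by positivity
  have hWlo : ∀ t, s ≤ t → x ^ 2 - 1 / x ≤ W t := fun t ht => hWs ▸
    le_of_hasDerivAt_nonneg ht (fun r hr => hW r hr.1) (fun r hr => (hpos r hr.1).le)
  have hWhi : ∀ t, s ≤ t → W t ≤ x ^ 2 := fun t ht =>
    le_of_hasDerivAt_nonneg_of_tendsto (fun r hr => hW r (ht.trans hr))
      (fun r hr => (hpos r (ht.trans hr)).le) W_top
  have hW1 : ∀ t, s ≤ t → 1 ≤ W t := fun t ht => by nlinarith [hWlo t ht]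
  have hWa : ∀ t, s ≤ t → 1 / W t ≤ a := fun t ht => by
    have h : 1 / a ≤ W t := by nlinarith [hWlo t ht]
    rw [div_le_iff₀ (by linarith [hW1 t ht])]
    rw [div_le_iff₀ ha] at h
    linarith
  set N : ℝ → ℝ := fun t => W t * exp (-2 * t + W t ^ 2 - a * W t) with hN
  set F : ℝ → ℝ := fun t => 2 * W t - a + 1 / W t with hF
  have hNpos : ∀ t, s ≤ t → 0 < N t := fun t ht =>
    mul_pos (by linarith [hW1 t ht]) (exp_pos _)
  have hF2 : ∀ t, s ≤ t → F t ≤ 2 * x ^ 2 := fun t ht => by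
    have := hWhi t ht; have := hWa t ht; simp only [hF]; linarith
  have hF1 : ∀ t, s ≤ t → x ^ 2 ≤ F t := fun t ht => by
    have h1 := hWlo t ht
    have h2 : 0 < 1 / W t := by have := hW1 t ht; positivity
    simp only [hF]; nlinarith
  have hNd : ∀ t, s ≤ t → HasDerivAt N (N t * (-2 + p t * F t)) t := fun t ht => by
    have h0 : W t ≠ 0 := by have := hW1 t ht; positivity
    have := (hW t ht).mul ((((hasDerivAt_id t).const_mul (-2)).add ((hW t ht).pow 2)).sub
      ((hW t ht).const_mul a)).exp
    refine this.congr_deriv ?_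
    simp [hN, hF]
    field_simp
    ring
  have hFd : ∀ t, s ≤ t → HasDerivAt F (p t * (2 - 1 / W t ^ 2)) t := fun t ht => by
    have h0 : W t ≠ 0 := by have := hW1 t ht; positivity
    have := ((((hW t ht).const_mul 2).sub_const a).add ((hW t ht).inv h0))
    simp only [hF, one_div]
    refine this.congr_deriv ?_
    field_simp
    ring
  have hWi : ∀ t, s ≤ t → 0 < 1 / W t ^ 2 ∧ 1 / W t ^ 2 ≤ 1 := fun t ht => by
    have := hW1 t ht
    refine ⟨by positivity, ?_⟩
    rw [div_le_one (by positivity)]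
    nlinarith
  have hN0 : Tendsto N atTop (𝓝 0) := by
    have h1 : Tendsto (fun t : ℝ => exp (-2 * t)) atTop (𝓝 0) :=
      tendsto_exp_atBot.comp ((tendsto_id).const_mul_atTop_of_neg (by norm_num))
    have h2 := (h1.mul ((W_top.pow 2).sub (W_top.const_mul a)).rexp).mul W_top
    simp only [zero_mul] at h2
    refine h2.congr fun t => ?_
    simp only [hN]
    rw [← exp_add, mul_comm]
    ring_nf
  have hx20 : (x ^ 2 : ℝ) ≠ 0 := by positivity
  have hF0 : Tendsto F atTop (𝓝 (2 * x ^ 2 - a + 1 / x ^ 2)) := by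
    simp only [hF, one_div]
    exact ((W_top.const_mul 2).sub_const a).add (W_top.inv₀ hx20)
  -- the Pohozaev type quantity
  set Q : ℝ → ℝ := fun t => N t - 2 * p t + F t * p t ^ 2 / 2 with hQ
  have hQd : ∀ t, s ≤ t → HasDerivAt Q (p t ^ 3 * (1 - 1 / W t ^ 2 / 2)) t := fun t ht => by
    have := ((hNd t ht).sub ((hp t ht).const_mul 2)).add
      (((hFd t ht).mul ((hp t ht).pow 2)).div_const 2)
    refine this.congr_deriv ?_
    simp [hN]
    ring
  have hQ0 : Tendsto Q atTop (𝓝 0) := by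
    have := (hN0.sub (p_top.const_mul 2)).add ((hF0.mul (p_top.pow 2)).div_const 2)
    simpa using this
  have hQneg : ∀ t, s ≤ t → Q t ≤ 0 := fun t ht =>
    le_of_hasDerivAt_nonneg_of_tendsto (fun r hr => hQd r (ht.trans hr))
      (fun r hr => by
        have h1 := (hWi r (ht.trans hr)).2
        have h2 := pow_pos (hpos r (ht.trans hr)) 3
        exact mul_nonneg h2.le (by linarith)) hQ0
  have hQlow : ∀ t, s ≤ t → 0 ≤ Q t + p t ^ 2 * (x ^ 2 - W t) := fun t ht => by
    have := le_of_hasDerivAt_nonneg_of_tendsto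
      (f := fun t => -(Q t + p t ^ 2 * (x ^ 2 - W t))) (L := -(0 + 0 ^ 2 * (x ^ 2 - x ^ 2)))
      (fun r hr => ((hQd r (ht.trans hr)).add
        (((hp r (ht.trans hr)).pow 2).mul ((hW r (ht.trans hr)).const_sub (x ^ 2)))).neg)
      (fun r hr => by
        have h1 := (hWi r (ht.trans hr)).1
        have h2 := pow_pos (hpos r (ht.trans hr)) 3
        have h3 := hNpos r (ht.trans hr)
        have h4 := hWhi r (ht.trans hr)
        have h5 := mul_nonneg (mul_nonneg (hpos r (ht.trans hr)).le h3.le) (sub_nonneg.2 h4)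
        have h6 := mul_pos h2 h1
        simp only [hN] at h5
        generalize exp (-2 * r + W r ^ 2 - a * W r) = e at h5 ⊢
        simp
        simp at h6
        nlinarith)
      (hQ0.add ((p_top.pow 2).mul (W_top.const_sub (x ^ 2)))).neg
    simp at this
    linarith
  set D : ℝ → ℝ := fun t => 2 - F t * p t / 2 with hD
  have hND : ∀ t, s ≤ t → N t ≤ p t * D t := fun t ht => by
    have := hQneg t ht
    simp only [hQ] at this
    simp only [hD]
    nlinarith
  have hDN : ∀ t, s ≤ t → p t * (D t - p t * (x ^ 2 - W t)) ≤ N t := fun t ht => by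
    have := hQlow t ht
    simp only [hQ] at this
    simp only [hD]
    nlinarith
  have hDpos : ∀ t, s ≤ t → 0 < D t := fun t ht => by
    have h1 := hND t ht
    have h2 := hNpos t ht
    exact (mul_pos_iff_of_pos_left (hpos t ht)).1 (h2.trans_le h1)
  have hFp : ∀ t, s ≤ t → F t * p t ≤ 4 := fun t ht => by
    have := hDpos t ht
    simp only [hD] at this
    linarith
  have hp4 : ∀ t, s ≤ t → p t ≤ 4 / x ^ 2 := fun t ht => by
    rw [le_div_iff₀ (by positivity)]
    have := mul_le_mul_of_nonneg_right (hF1 t ht) (hpos t ht).le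
    have := hFp t ht
    linarith
  have hDd : ∀ t, s ≤ t → HasDerivAt D (F t * N t / 2 - p t ^ 2 * (2 - 1 / W t ^ 2) / 2) t :=
    fun t ht => by
    have := (((hFd t ht).mul (hp t ht)).div_const 2).const_sub 2
    refine this.congr_deriv ?_
    simp [hN]
    ring
  have hD0 : Tendsto D atTop (𝓝 2) := by
    have := ((hF0.mul p_top).div_const 2).const_sub 2
    simpa using this
  have hwin : ∀ t, s ≤ t → x ^ 2 - W t ≤ 1 / x := fun t ht => by
    have := hWlo t ht; linarith
  have hDs : D s ≤ 6 / x ^ 3 := by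
    have hV := le_of_hasDerivAt_nonneg_of_tendsto
      (f := fun t => (D t - 5 / x ^ 3) * exp (-(x ^ 2 / 2) * W t))
      (L := (2 - 5 / x ^ 3) * exp (-(x ^ 2 / 2) * x ^ 2)) (s := s)
      (fun r hr => ((hDd r hr).sub_const (5 / x ^ 3)).mul
        ((hW r hr).const_mul (-(x ^ 2 / 2))).exp)
      (fun r hr => by
        have e1 := exp_pos (-(x ^ 2 / 2) * W r)
        suffices h : 0 ≤ (F r * N r / 2 - p r ^ 2 * (2 - 1 / W r ^ 2) / 2) -
            (D r - 5 / x ^ 3) * (x ^ 2 / 2) * p r by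
          have := mul_nonneg h e1.le
          linarith
        have h1 := hDN r hr
        have hp0 := hpos r hr
        have h2 := mul_le_mul_of_nonneg_left h1 (a := F r / 2)
          (by have := hF1 r hr; nlinarith)
        have h3 : 0 ≤ (F r - x ^ 2) * (D r * p r) :=
          mul_nonneg (by linarith [hF1 r hr]) (mul_pos (hDpos r hr) hp0).le
        have h4 : F r * p r * (p r * (x ^ 2 - W r)) ≤ 4 * (p r * (1 / x)) := by
          apply mul_le_mul (hFp r hr) _ _ (by norm_num)
          · exact mul_le_mul_of_nonneg_left (hwin r hr) hp0.le
          · exact mul_nonneg hp0.le (by linarith [hWhi r hr])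
        have h5 : p r * p r ≤ p r * (4 / x ^ 2) := mul_le_mul_of_nonneg_left (hp4 r hr) hp0.le
        have h6 := (hWi r hr).1
        have h7 : 4 / x ^ 2 ≤ 1 / x / 2 := by
          rw [div_le_iff₀ (by positivity)]
          field_simp
          linarith
        have h8 : 5 / x ^ 3 * (x ^ 2 / 2) = 5 / 2 * (1 / x) := by
          field_simp
        have h9 : (D r - 5 / x ^ 3) * (x ^ 2 / 2) * p r
          = D r * p r * x ^ 2 / 2 - 5 / 2 * (1 / x) * p r := by rw [← h8]; ring
        rw [h9]
        have h10 : 0 ≤ p r ^ 2 * (1 / W r ^ 2) := by positivity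
        have h11 := mul_le_mul_of_nonneg_left h7 hp0.le
        nlinarith)
      (((hD0.sub_const _)).mul (W_top.const_mul _).rexp)
    have e1 := exp_pos (-(x ^ 2 / 2) * W s)
    have e2 : exp (-(x ^ 2 / 2) * x ^ 2) = exp (-(x / 2)) * exp (-(x ^ 2 / 2) * W s) := by
      rw [← exp_add, hWs]
      congr 1
      field_simp
      ring
    have hV' : (D s - 5 / x ^ 3) * exp (-(x ^ 2 / 2) * W s) ≤
        (1 / x ^ 3) * exp (-(x ^ 2 / 2) * W s) := by
      refine hV.trans ?_
      rw [e2, ← mul_assoc]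
      apply mul_le_mul_of_nonneg_right _ e1.le
      have h1 : 0 ≤ 5 / x ^ 3 * exp (-(x / 2)) := by positivity
      linarith
    have := le_of_mul_le_mul_right hV' e1
    have h6 : 6 / x ^ 3 = 5 / x ^ 3 + 1 / x ^ 3 := by ring
    linarith
  have hx3 : 6 / x ^ 3 ≤ 1 / 8 := by
    rw [div_le_iff₀ (by positivity)]
    nlinarith [pow_le_pow_left₀ (by norm_num) hx 3]
  refine ⟨?_, ?_, ?_, ?_⟩
  · rw [le_div_iff₀ (hpos s le_rfl)]
    have h1 := hFp s le_rfl
    have h2 : 0 < 1 / W s := by have := hW1 s le_rfl; positivity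
    have h3 : 2 * (x ^ 2 - a / 2 - 1 / x) ≤ F s := by simp only [hF, hWs] at h2 ⊢; linarith
    have := mul_le_mul_of_nonneg_right h3 (hpos s le_rfl).le
    linarith
  · rw [div_le_iff₀ (hpos s le_rfl)]
    have h1 : F s * p s = 4 - 2 * D s := by simp only [hD]; ring
    have h2 : 1 / W s ≤ 2 / x := by
      apply (div_le_div_iff₀ (by linarith [hW1 s le_rfl]) hx0).2
      rw [hWs]
      nlinarith
    have h3 : F s ≤ 2 * (x ^ 2 - a / 2) := by
      simp only [hF]; rw [hWs] at h2 ⊢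
      have : 2 / x = 2 * (1 / x) := by ring
      linarith
    have h4 : (4 - 2 * D s) * (x ^ 2 - a / 2 + 6 / x) ≥ 4 * (x ^ 2 - a / 2) := by
      have hx3' : 0 < 6 / x ^ 3 := by positivity
      have h5 : (4 - 2 * (6 / x ^ 3)) * (x ^ 2 - a / 2 + 6 / x) ≥ 4 * (x ^ 2 - a / 2) := by
        have h6 : 6 / x = 6 / x ^ 3 * x ^ 2 := by field_simp
        rw [h6]
        nlinarith [mul_pos hx3' ha, mul_nonneg hx3'.le
          (mul_nonneg (sub_nonneg.2 hx3) (sq_nonneg x)), mul_pos hx3' (pow_pos hx0 2)]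
      refine ge_trans ?_ h5
      apply mul_le_mul_of_nonneg_right (by linarith)
      have : 0 < 6 / x := by positivity
      nlinarith
    have h7 : 0 < F s := by have := hF1 s le_rfl; nlinarith
    have h8 : F s * 2 ≤ F s * ((x ^ 2 - a / 2 + 6 / x) * p s) := by
      have : F s * ((x ^ 2 - a / 2 + 6 / x) * p s) =
        (4 - 2 * D s) * (x ^ 2 - a / 2 + 6 / x) := by rw [← h1]; ring
      rw [this]; linarith
    exact le_of_mul_le_mul_left h8 h7
  · exact (hND s le_rfl).trans (mul_le_mul_of_nonneg_left hDs (hpos s le_rfl).le)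
  · -- a point where `D = 1`
    obtain ⟨c, hsc, hc⟩ : ∃ c, s ≤ c ∧ D c = 1 := by
      have h1 : ∀ᶠ t in atTop, 1 < D t := hD0.eventually (lt_mem_nhds (by norm_num))
      obtain ⟨T, hT1, hT2⟩ := (h1.and (eventually_ge_atTop s)).exists
      have hcont : ContinuousOn D (Icc s T) := fun r hr =>
        (hDd r hr.1).continuousAt.continuousWithinAt
      obtain ⟨r, hr, hr2⟩ := intermediate_value_Icc hT2 hcont ⟨by linarith, hT1.le⟩
      exact ⟨r, hr.1, hr2⟩
    have h1 : F c * p c = 2 := by simp only [hD] at hc; linarith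
    have hpc := hpos c hsc
    have h2 : 1 / x ^ 2 ≤ p c := by
      rw [div_le_iff₀ (by positivity)]
      nlinarith [mul_le_mul_of_nonneg_right (hF2 c hsc) hpc.le]
    have h3 : p c * (x ^ 2 - W c) ≤ 1 / 2 := by
      have h4 : p c * (x ^ 2 - W c) ≤ 4 / x ^ 2 * (1 / x) :=
        mul_le_mul (hp4 c hsc) (hwin c hsc) (by linarith [hWhi c hsc]) (by positivity)
      have h5 : 4 / x ^ 2 ≤ 1 := by
        rw [div_le_one (by positivity)]; nlinarith
      have h6 : 4 / x ^ 2 * (1 / x) ≤ 1 * (1 / 8) :=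
        mul_le_mul h5 hx1 hx1'.le (by norm_num)
      linarith
    have h4 : 1 / (2 * x ^ 2) ≤ N c := by
      have h5 := hDN c hsc
      rw [hc] at h5
      have h6 : 1 / (2 * x ^ 2) = 1 / x ^ 2 / 2 := by field_simp
      rw [h6]
      nlinarith
    have h5 := le_of_hasDerivAt_nonneg (f := fun t => -(N t * exp (-x ^ 2 * W t))) hsc
      (fun r hr => ((hNd r hr.1).mul ((hW r hr.1).const_mul (-x ^ 2)).exp).neg)
      (fun r hr => by
        have e1 := exp_pos (-x ^ 2 * W r)
        have h6 := mul_pos (hNpos r hr.1) e1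
        have h7 : 0 ≤ x ^ 2 * p r + 2 - p r * F r := by
          have h8 := hFp r hr.1
          have h9 := mul_le_mul_of_nonneg_right (hF2 r hr.1) (hpos r hr.1).le
          linarith
        have := mul_nonneg h6.le h7
        linarith)
    have e1 := exp_pos (-x ^ 2 * W s)
    have h6 : N c * exp (-x ^ 2 * x ^ 2) ≤ N s * exp (-x ^ 2 * W s) := by
      refine le_trans ?_ (neg_le_neg_iff.1 h5)
      apply mul_le_mul_of_nonneg_left _ (hNpos c hsc).le
      apply exp_le_exp.2
      nlinarith [hWhi c hsc, sq_nonneg x]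
    have e2 : exp (-x ^ 2 * x ^ 2) = exp (-x) * exp (-x ^ 2 * W s) := by
      rw [← exp_add, hWs]
      congr 1
      field_simp
      ring
    rw [e2, ← mul_assoc] at h6
    have h7 := le_of_mul_le_mul_right h6 e1
    refine le_trans ?_ h7
    have h8 := mul_le_mul_of_nonneg_right h4 (exp_pos (-x)).le
    refine le_trans (le_of_eq ?_) h8
    field_simp

/-- Below the peak the slope stays almost constant down to the height `a/2 + δ`. -/
lemma neck_slope_le {g : ℝ → ℝ} {W p A : ℝ → ℝ} {s0 E a x s C δ : ℝ}
    (S : LogSol g s0 (x ^ 2) W p A E) (hx : 8 ≤ x)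
    (hC0 : 0 < C) (hC : ∀ t, 0 ≤ t → g t ≤ C * exp (t ^ 2 - a * t))
    (hδ : 0 < δ) (hxδ : 7 / x ≤ δ / 2) (hxa : a / 2 + δ / 2 ≤ x ^ 2 / 4)
    (hexp : x ^ 4 * exp (-(x ^ 2 * δ / 8)) ≤ 1)
    (hs : s0 < s) (hWs : W s = x ^ 2 - 1 / x)
    (h2 : 2 / p s ≤ x ^ 2 - a / 2 + 6 / x)
    (h3 : W s * exp (-2 * s + W s ^ 2 - a * W s) ≤ p s * (6 / x ^ 3))
    {r : ℝ} (hr : s0 < r) (hrs : r ≤ s) (hWr : a / 2 + δ ≤ W r) :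
    p r ≤ p s + 30 * C / x ^ 5 := by
  have hx0 : 0 < x := by linarith
  have hx1 : 1 / x ≤ 1 / 8 := one_div_le_one_div_of_le (by norm_num) hx
  have hx1' : 0 < 1 / x := by positivity
  have hps := S.p_pos hs
  set e1 : ℝ := exp (-(x ^ 2 * δ / 8)) with he1
  have hN : ∀ t ∈ Icc r s, exp (-2 * t) * (W t * g (W t)) ≤
      C * (6 / x ^ 3) * (exp (-(W s - W t) * (x ^ 2 / 4)) + e1) * p t := by
    intro t ht
    have ht0 : s0 < t := hr.trans_le ht.1
    have hWt : a / 2 + δ ≤ W t := hWr.trans (S.W_mono hr ht.1)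
    have hWts : W t ≤ W s := S.W_mono ht0 ht.2
    have hWt0 := S.pos t ht0
    have k1 : exp (-2 * t) * (W t * g (W t)) ≤ C * (W s * exp (-2 * t + W t ^ 2 - a * W t)) := by
      have := hC (W t) hWt0.le
      calc exp (-2 * t) * (W t * g (W t)) ≤
          exp (-2 * t) * (W s * (C * exp (W t ^ 2 - a * W t))) := by
            have := (S.gpos t ht0).le
            have := hWt0.le.trans hWts
            gcongr
        _ = _ := by
            rw [show -2 * t + W t ^ 2 - a * W t = -2 * t + (W t ^ 2 - a * W t) by ring, exp_add]
            ring
    have k2 : -2 * t + W t ^ 2 - a * W t ≤ (-2 * s + W s ^ 2 - a * W s) +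
        -(W s - W t) * (W t - a / 2 - δ / 2) := by
      have k3 : s - t ≤ (W s - W t) / p s := by
        rw [le_div_iff₀ hps]
        have := S.W_le_tangent ht0 ht.2
        linarith
      have k4 : 2 * ((W s - W t) / p s) = (2 / p s) * (W s - W t) := by ring
      have k5 : (2 / p s) * (W s - W t) ≤ (x ^ 2 - a / 2 + 6 / x) * (W s - W t) :=
        mul_le_mul_of_nonneg_right h2 (sub_nonneg.2 hWts)
      have k6 : 0 ≤ (W s - W t) * (W s - x ^ 2 - 6 / x + δ / 2) := by
        apply mul_nonneg (sub_nonneg.2 hWts)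
        rw [hWs]
        have : 7 / x = 1 / x + 6 / x := by ring
        linarith
      nlinarith
    have k7 : exp (-(W s - W t) * (W t - a / 2 - δ / 2)) ≤
        exp (-(W s - W t) * (x ^ 2 / 4)) + e1 := by
      rcases le_total (x ^ 2 / 2) (W t) with h | h
      · have : exp (-(W s - W t) * (W t - a / 2 - δ / 2)) ≤ exp (-(W s - W t) * (x ^ 2 / 4)) := by
          apply exp_le_exp.2
          have := mul_nonneg (sub_nonneg.2 hWts) (show 0 ≤ W t - a / 2 - δ / 2 - x ^ 2 / 4 by
            linarith)
          linarith
        have := exp_pos (-(x ^ 2 * δ / 8))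
        linarith
      · have : exp (-(W s - W t) * (W t - a / 2 - δ / 2)) ≤ e1 := by
          apply exp_le_exp.2
          have l1 : x ^ 2 / 4 ≤ W s - W t := by rw [hWs]; nlinarith
          have := mul_le_mul l1 (show δ / 2 ≤ W t - a / 2 - δ / 2 by linarith) (by positivity)
            (sub_nonneg.2 hWts)
          linarith
        have := exp_pos (-(W s - W t) * (x ^ 2 / 4))
        linarith
    have hWs0 := S.pos s hs
    calc exp (-2 * t) * (W t * g (W t)) ≤ C * (W s * exp (-2 * t + W t ^ 2 - a * W t)) := k1
      _ ≤ C * (W s * (exp (-2 * s + W s ^ 2 - a * W s) *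
          exp (-(W s - W t) * (W t - a / 2 - δ / 2)))) := by
          rw [← exp_add]; gcongr
      _ = C * ((W s * exp (-2 * s + W s ^ 2 - a * W s)) *
          exp (-(W s - W t) * (W t - a / 2 - δ / 2))) := by ring
      _ ≤ C * ((p t * (6 / x ^ 3)) * (exp (-(W s - W t) * (x ^ 2 / 4)) + e1)) := by
          have := S.p_anti ht0 ht.2
          have h4 := h3.trans (mul_le_mul_of_nonneg_right this (show 0 ≤ 6 / x ^ 3 by positivity))
          have := S.p_pos ht0
          gcongr
      _ = _ := by ring
  have hB := le_of_hasDerivAt_nonneg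
    (f := fun t => p t + C * (6 / x ^ 3) *
      ((4 / x ^ 2) * exp (-(W s - W t) * (x ^ 2 / 4)) + e1 * W t)) hrs
    (fun t ht => (S.hp t (hr.trans_le ht.1)).add (((((((S.hW t (hr.trans_le ht.1)).const_sub
      (W s)).neg.mul_const (x ^ 2 / 4)).exp).const_mul (4 / x ^ 2)).add
      ((S.hW t (hr.trans_le ht.1)).const_mul e1)).const_mul (C * (6 / x ^ 3))))
    (fun t ht => by
      have := hN t ht
      have e : 4 / x ^ 2 * (exp (-(W s - W t) * (x ^ 2 / 4)) * (- -p t * (x ^ 2 / 4))) =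
        exp (-(W s - W t) * (x ^ 2 / 4)) * p t := by field_simp
      simp only [Pi.neg_apply] at e ⊢
      rw [e]
      linarith)
  have he0 : 0 < e1 := exp_pos _
  have hWr0 := S.pos r hr
  have l1 : 0 ≤ C * (6 / x ^ 3) *
      ((4 / x ^ 2) * exp (-(W s - W r) * (x ^ 2 / 4)) + e1 * W r) := by positivity
  have l2 : C * (6 / x ^ 3) * ((4 / x ^ 2) * exp (-(W s - W s) * (x ^ 2 / 4)) + e1 * W s) ≤
      30 * C / x ^ 5 := by
    have l3 : e1 * W s ≤ 1 / x ^ 2 := by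
      rw [le_div_iff₀ (by positivity)]
      have : W s ≤ x ^ 2 := by rw [hWs]; linarith
      calc e1 * W s * x ^ 2 ≤ e1 * x ^ 2 * x ^ 2 := by gcongr
        _ = x ^ 4 * e1 := by ring
        _ ≤ 1 := hexp
    calc _ ≤ C * (6 / x ^ 3) * ((4 / x ^ 2) * 1 + 1 / x ^ 2) := by
          gcongr
          simp
      _ = _ := by field_simp; norm_num
  linarith

set_option maxHeartbeats 1000000 in
/-- Quantitative description of a solution with large height `x²` down to the height `a/2 + δ`. -/
lemma neck_estimates {g : ℝ → ℝ} {W p A : ℝ → ℝ} {s0 E a c0 x C δ : ℝ}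
    (S : LogSol g s0 (x ^ 2) W p A E) (ha : 0 < a) (hx : 8 ≤ x)
    (hg : ∀ t, c0 ≤ t → g t = exp (t ^ 2 - a * t))
    (hC0 : 0 < C) (hC : ∀ t, 0 ≤ t → g t ≤ C * exp (t ^ 2 - a * t))
    (hδ : 0 < δ) (hxδ : 7 / x ≤ δ / 2) (hxa : a / 2 + δ ≤ x ^ 2 / 4) (hc0 : c0 ≤ x ^ 2 / 2)
    (hax : a + 1 / a + 3 ≤ x ^ 2 / 2) (hex : 2 * exp (-(x / 2)) ≤ 1 / x ^ 3)
    (hexp : x ^ 4 * exp (-(x ^ 2 * δ / 8)) ≤ 1)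
    (k1 : x ^ 2 * (δ + (1 + 60 * C) / x) + (a / 2 + δ) ^ 2 + x + log (x ^ 2) + log (2 * x ^ 2) ≤
      2 * δ * x ^ 2)
    (k2 : x ^ 2 / 2 ≤ x ^ 2 - a / 2 - (1 + 60 * C) / x)
    (k3 : x ^ 2 * 2 ≤ (2 + δ) * (x ^ 2 - a / 2 - (1 + 60 * C) / x))
    (k4 : (2 - δ) * (x ^ 2 - a / 2 + 6 / x) ≤ 2 * (x ^ 2 - 1 / x))
    (k5 : 2 / δ ≤ x ^ 2 * δ / 8 - a ^ 2 / 4) :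
    ∃ r, s0 < r ∧ W r = a / 2 + δ ∧ 1 / δ ≤ r ∧ p r * r ≤ 4 * δ ∧ |A r - 2| ≤ δ := by
  have hx0 : 0 < x := by linarith
  have hx1 : 1 / x ≤ 1 / 8 := one_div_le_one_div_of_le (by norm_num) hx
  have hx1' : 0 < 1 / x := by positivity
  have hx2 : 64 ≤ x ^ 2 := by nlinarith
  obtain ⟨s, hs, hWs⟩ : ∃ s, s0 < s ∧ W s = x ^ 2 - 1 / x := by
    have h1 : ∀ᶠ t in atTop, x ^ 2 - 1 / x < W t := S.W_top.eventually (lt_mem_nhds (by linarith))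
    obtain ⟨T, hT1, hT2⟩ := (h1.and (eventually_gt_atTop s0)).exists
    obtain ⟨s, hs, -, hs2⟩ := S.exists_height (h := x ^ 2 - 1 / x) (by linarith) hT2 hT1.le
    exact ⟨s, hs, hs2⟩
  have hgW : ∀ t, s ≤ t → exp (-2 * t) * (W t * g (W t)) =
      W t * exp (-2 * t + W t ^ 2 - a * W t) := fun t ht => by
    have : c0 ≤ W t := by have := S.W_mono hs ht; linarith
    rw [hg _ this, show -2 * t + W t ^ 2 - a * W t = -2 * t + (W t ^ 2 - a * W t) by ring, exp_add]
    ring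
  obtain ⟨h1, h2, h3, h4⟩ := peak_estimates ha hx hax hex (s := s) (W := W) (p := p)
    (fun t ht => S.hW t (hs.trans_le ht))
    (fun t ht => by rw [← hgW t ht]; exact S.hp t (hs.trans_le ht)) S.W_top S.p_top
    (fun t ht => S.p_pos (hs.trans_le ht)) hWs
  have hps := S.p_pos hs
  obtain ⟨r, hr, hrs, hWr⟩ := S.exists_height (h := a / 2 + δ) (by linarith) hs
    (by rw [hWs]; linarith)
  have hup : ∀ t ∈ Icc r s, p t ≤ p s + 30 * C / x ^ 5 := fun t ht =>
    neck_slope_le S hx hC0 hC hδ hxδ (by linarith) hexp hs hWs h2 h3 (hr.trans_le ht.1) ht.2 (hWr ▸ S.W_mono hr ht.1)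
  set P := p s + 30 * C / x ^ 5 with hP
  have hP0 : 0 < P := by positivity
  have hq : 2 / p s ≤ 2 * x ^ 2 := by
    have : 6 / x = 6 * (1 / x) := by ring
    linarith
  have hPlow : x ^ 2 - a / 2 - (1 + 60 * C) / x ≤ 2 / P := by
    have e1 : 2 / P = 2 / p s - 2 * (30 * C / x ^ 5) / (P * p s) := by
      rw [hP]; field_simp; ring
    have e2 : 2 * (30 * C / x ^ 5) / (P * p s) ≤ 60 * C / x := by
      have l1 : 1 / x ^ 2 ≤ p s := by
        rw [div_le_iff₀ hps] at hq
        rw [div_le_iff₀ (by positivity)]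
        linarith
      have l2 : 1 / x ^ 2 * (1 / x ^ 2) ≤ P * p s := by
        have : p s ≤ P := by rw [hP]; have : 0 < 30 * C / x ^ 5 := by positivity
                             linarith
        exact mul_le_mul (l1.trans this) l1 (by positivity) hP0.le
      calc _ ≤ 2 * (30 * C / x ^ 5) / (1 / x ^ 2 * (1 / x ^ 2)) := by gcongr
        _ = _ := by field_simp; norm_num
    have e3 : (1 + 60 * C) / x = 1 / x + 60 * C / x := by ring
    linarith
  have hNs0 : 0 < W s * exp (-2 * s + W s ^ 2 - a * W s) := mul_pos (S.pos s hs) (exp_pos _)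
  have hlog : log (W s * exp (-2 * s + W s ^ 2 - a * W s)) =
      log (W s) + (-2 * s + W s ^ 2 - a * W s) := by
    rw [log_mul (S.pos s hs).ne' (exp_pos _).ne', log_exp]
  have hWrs : W r ≤ W s := S.W_mono hr hrs
  have hWsx : W s ≤ x ^ 2 := by rw [hWs]; linarith
  -- upper bound for `r`
  have hrup : r ≤ δ * x ^ 2 := by
    have l1 : W s - W r ≤ P * (s - r) :=
      (S.tangent_le_W hr hrs).trans (mul_le_mul_of_nonneg_right (hup r ⟨le_rfl, hrs⟩)
        (sub_nonneg.2 hrs))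
    have l2 : (2 / P) * (W s - W r) ≤ 2 * (s - r) := by
      rw [div_mul_eq_mul_div, div_le_iff₀ hP0]; linarith
    have l3 := mul_le_mul_of_nonneg_right hPlow (sub_nonneg.2 hWrs)
    have l4 : -x - log (2 * x ^ 2) ≤ log (W s) + (-2 * s + W s ^ 2 - a * W s) := by
      rw [← hlog]
      have := log_le_log (by positivity) h4
      rw [log_div (exp_pos _).ne' (by positivity), log_exp] at this
      exact this
    have l5 : log (W s) ≤ log (x ^ 2) := log_le_log (S.pos s hs) hWsx
    have l6 : (W s - W r) * (W s + W r - a - (x ^ 2 - a / 2 - (1 + 60 * C) / x)) ≤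
        x ^ 2 * (δ + (1 + 60 * C) / x) := by
      have m1 : 0 < (1 + 60 * C) / x := by positivity
      have m2 : W s + W r - a - (x ^ 2 - a / 2 - (1 + 60 * C) / x) ≤ δ + (1 + 60 * C) / x := by
        rw [hWr]; linarith
      have m3 : W s - W r ≤ x ^ 2 := by have := S.pos r hr; linarith
      calc _ ≤ (W s - W r) * (δ + (1 + 60 * C) / x) :=
            mul_le_mul_of_nonneg_left m2 (sub_nonneg.2 hWrs)
        _ ≤ _ := mul_le_mul_of_nonneg_right m3 (by positivity)
    have l7 : 0 ≤ a * W r := (mul_pos ha (S.pos r hr)).le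
    rw [hWr] at l2 l3 l6 l7
    nlinarith
  have hrlow : 1 / δ ≤ r := by
    have l1 := S.W_le_tangent hr hrs
    have l2 : 2 * (s - r) ≤ (2 / p s) * (W s - W r) := by
      rw [div_mul_eq_mul_div, le_div_iff₀ hps]; linarith
    have l3 := mul_le_mul_of_nonneg_right h2 (sub_nonneg.2 hWrs)
    have l4 : log (W s) + (-2 * s + W s ^ 2 - a * W s) ≤ log (W s) := by
      rw [← hlog]
      apply log_le_log hNs0
      refine h3.trans ?_
      have m1 : p s ≤ 4 / x ^ 2 := by
        have : x ^ 2 / 2 ≤ 2 / p s := by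
          have : 0 ≤ 60 * C / x := by positivity
          have e3 : (1 + 60 * C) / x = 1 / x + 60 * C / x := by ring
          linarith
        rw [le_div_iff₀ hps] at this
        rw [le_div_iff₀ (by positivity)]
        linarith
      have m2 : 4 / x ^ 2 ≤ 1 := by rw [div_le_one (by positivity)]; linarith
      have m3 : 6 / x ^ 3 ≤ 1 := by
        rw [div_le_one (by positivity)]; nlinarith
      calc p s * (6 / x ^ 3) ≤ 1 * 1 := mul_le_mul (m1.trans m2) m3 (by positivity) (by norm_num)
        _ ≤ W s := by rw [hWs]; linarith
    have l6 : x ^ 2 / 4 * (δ / 2) ≤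
        (W s - W r) * (W s + W r - a - (x ^ 2 - a / 2 + 6 / x)) := by
      apply mul_le_mul
      · rw [hWr, hWs]; linarith
      · rw [hWr, hWs]
        have : 7 / x = 1 / x + 6 / x := by ring
        linarith
      · positivity
      · linarith
    have l7 : 0 ≤ (W r - a / 2) ^ 2 := sq_nonneg _
    have l8 : 1 / δ = 2 / δ / 2 := by ring
    nlinarith
  have hr0 : 0 < r := lt_of_lt_of_le (by positivity) hrlow
  have hPr := hup r ⟨le_rfl, hrs⟩
  refine ⟨r, hr, hWr, hrlow, ?_, ?_⟩
  · have l1 : P * x ^ 2 ≤ 4 := by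
      have := k2.trans hPlow
      rw [le_div_iff₀ hP0] at this
      linarith
    calc p r * r ≤ P * (δ * x ^ 2) := mul_le_mul hPr hrup hr0.le hP0.le
      _ = δ * (P * x ^ 2) := by ring
      _ ≤ δ * 4 := mul_le_mul_of_nonneg_left l1 hδ.le
      _ = 4 * δ := by ring
  · rw [abs_le]
    constructor
    · have l1 := S.A_anti hr hrs
      have l2 := S.le_A hs
      have l3 : 2 - δ ≤ W s * p s := by
        rw [div_le_iff₀ hps] at h2
        have hY : 0 < x ^ 2 - a / 2 + 6 / x := by
          have : 0 < 6 / x := by positivity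
          nlinarith
        have : (2 - δ) * (x ^ 2 - a / 2 + 6 / x) ≤
            (W s * p s) * (x ^ 2 - a / 2 + 6 / x) := by
          rw [hWs]
          have m : 0 < x ^ 2 - 1 / x := by linarith
          nlinarith
        exact le_of_mul_le_mul_right this hY
      linarith
    · have l1 := S.A_le hr
      have l2 : x ^ 2 * P ≤ 2 + δ := by
        rw [le_div_iff₀ hP0] at hPlow
        have := mul_le_mul_of_nonneg_right k3 hP0.le
        nlinarith
      have l3 : x ^ 2 * p r ≤ x ^ 2 * P := mul_le_mul_of_nonneg_left hPr (by positivity)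
      linarith

/-- Every solution of sufficiently large height `γ` reaches the height `a/2 + δ` far from the
boundary, with a small slope, and with energy almost equal to that of one peak above it. -/
lemma eventually_neck {g : ℝ → ℝ} {a c0 C δ : ℝ} (ha : 0 < a)
    (hg : ∀ t, c0 ≤ t → g t = exp (t ^ 2 - a * t))
    (hC0 : 0 < C) (hC : ∀ t, 0 ≤ t → g t ≤ C * exp (t ^ 2 - a * t)) (hδ : 0 < δ) (hδ1 : δ ≤ 1) :
    ∀ᶠ γ : ℝ in atTop, ∀ (s0 : ℝ) (W p A : ℝ → ℝ) (E : ℝ), LogSol g s0 γ W p A E →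
      ∃ r, s0 < r ∧ W r = a / 2 + δ ∧ 1 / δ ≤ r ∧ p r * r ≤ 4 * δ ∧ |A r - 2| ≤ δ := by
  suffices h : ∀ᶠ x : ℝ in atTop, ∀ (s0 : ℝ) (W p A : ℝ → ℝ) (E : ℝ),
      LogSol g s0 (x ^ 2) W p A E →
      ∃ r, s0 < r ∧ W r = a / 2 + δ ∧ 1 / δ ≤ r ∧ p r * r ≤ 4 * δ ∧ |A r - 2| ≤ δ by
    filter_upwards [tendsto_sqrt_atTop.eventually h, eventually_ge_atTop 0] with γ hγ h0
    rwa [sq_sqrt h0] at hγ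
  have e1 : ∀ᶠ x : ℝ in atTop, 2 * exp (-(x / 2)) ≤ 1 / x ^ 3 := by
    have h1 : Tendsto (fun x : ℝ => x / 2) atTop atTop := tendsto_id.atTop_div_const (by norm_num)
    have h2 := (tendsto_pow_mul_exp_neg_atTop_nhds_zero 3).comp h1
    filter_upwards [h2.eventually (gt_mem_nhds (show (0:ℝ) < 1 / 16 by norm_num)),
      eventually_gt_atTop 0] with x hx hx0
    rw [le_div_iff₀ (by positivity)]
    simp only [Function.comp] at hx
    nlinarith
  have e2 : ∀ᶠ x : ℝ in atTop, x ^ 4 * exp (-(x ^ 2 * δ / 8)) ≤ 1 := by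
    have h1 : Tendsto (fun x : ℝ => x ^ 2 * δ / 8) atTop atTop :=
      ((tendsto_pow_atTop two_ne_zero).atTop_mul_const hδ).atTop_div_const (by norm_num)
    have h2 := (tendsto_pow_mul_exp_neg_atTop_nhds_zero 2).comp h1
    filter_upwards [h2.eventually (gt_mem_nhds (show 0 < δ ^ 2 / 64 by positivity))] with x hx
    simp only [Function.comp] at hx
    have h3 : x ^ 4 * exp (-(x ^ 2 * δ / 8)) * (δ ^ 2 / 64) < 1 * (δ ^ 2 / 64) := by
      calc _ = (x ^ 2 * δ / 8) ^ 2 * exp (-(x ^ 2 * δ / 8)) := by ring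
        _ < _ := by linarith
    exact (lt_of_mul_lt_mul_right h3 (by positivity)).le
  have big : ∀ c K : ℝ, 0 < c → ∀ᶠ x : ℝ in atTop, K ≤ c * x ^ 2 := fun c K hc =>
    ((tendsto_pow_atTop two_ne_zero).const_mul_atTop hc).eventually_ge_atTop K
  set D := 1 + 60 * C with hD
  filter_upwards [e1, e2, eventually_ge_atTop 8, eventually_ge_atTop (14 / δ),
    big (1 / 4) (a / 2 + δ) (by norm_num), big (1 / 2) c0 (by norm_num),
    big (1 / 2) (a + 1 / a + 3) (by norm_num),
    eventually_ge_atTop ((D + 6 + (a / 2 + δ) ^ 2) / δ), big (1 / 2) (a / 2 + D) (by norm_num),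
    big δ ((2 + δ) * (a / 2 + D)) hδ, big δ 14 hδ,
    big (δ / 8) (2 / δ + a ^ 2 / 4) (by positivity)]
    with x h1 h2 h3 h4 h5 h6 h7 h8 h9 h10 h11 h12
  intro s0 W p A E S
  have hx0 : 0 < x := by linarith
  have hDx : D / x ≤ D := div_le_self (by positivity) (by linarith)
  have h1x : 1 / x ≤ 1 := (div_le_one hx0).2 (by linarith)
  have h6x : 6 / x = 6 * (1 / x) := by ring
  have hlx : log x ≤ x := log_le_self hx0.le
  refine neck_estimates S ha h3 hg hC0 hC hδ ?_ (by linarith) (by linarith) (by linarith) h1 h2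
    ?_ (by linarith) ?_ ?_ (by linarith)
  · rw [div_le_iff₀ hδ] at h4
    rw [div_le_iff₀ hx0]; linarith
  · rw [log_mul two_ne_zero (by positivity), log_pow]
    have : log 2 ≤ 2 := log_le_self (by norm_num)
    rw [div_le_iff₀ hδ] at h8
    have e3 : x ^ 2 * (δ + D / x) = δ * x ^ 2 + D * x := by field_simp
    rw [e3]
    have e4 := mul_le_mul_of_nonneg_right h8 hx0.le
    push_cast
    nlinarith [mul_nonneg (sq_nonneg (a / 2 + δ)) (show 0 ≤ x - 1 by linarith)]
  · have := mul_le_mul_of_nonneg_left hDx (show 0 ≤ 2 + δ by linarith)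
    nlinarith
  · have l1 : 0 ≤ (2 - δ) * (a / 2) := by apply mul_nonneg <;> linarith
    have l2 : (2 - δ) * (6 / x) ≤ 12 := by
      have : 0 < 1 / x := by positivity
      nlinarith
    nlinarith

namespace LogSol

variable {g : ℝ → ℝ} {s0 γ : ℝ} {W p A : ℝ → ℝ} {E : ℝ}
  {s1 ψ0 : ℝ} {Ψ q B : ℝ → ℝ} {E1 : ℝ}

lemma top_pos (S : LogSol g s0 γ W p A E) : 0 < γ :=
  (S.pos (s0 + 1) (by linarith)).trans_le (S.W_le (by linarith))

lemma hasDerivAt_wronskian (S : LogSol g s0 γ W p A E) (T : LogSol (fun _ => 1) s1 ψ0 Ψ q B E1)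
    {s : ℝ} (h0 : s0 < s) (h1 : s1 < s) :
    HasDerivAt (fun t => p t * Ψ t - W t * q t)
      (exp (-2 * s) * (W s * Ψ s) * (1 - g (W s))) s := by
  refine (((S.hp s h0).mul (T.hW s h1)).sub ((S.hW s h0).mul (T.hp s h1))).congr_deriv ?_
  ring

lemma hasDerivAt_quotient (S : LogSol g s0 γ W p A E) (T : LogSol (fun _ => 1) s1 ψ0 Ψ q B E1)
    {s : ℝ} (h0 : s0 < s) (h1 : s1 < s) :
    HasDerivAt (fun t => W t / Ψ t) ((p s * Ψ s - W s * q s) / Ψ s ^ 2) s :=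
  (S.hW s h0).div (T.hW s h1) (T.pos s h1).ne'

lemma linear_slope_le (T : LogSol (fun _ => 1) s1 ψ0 Ψ q B E1) {s : ℝ} (h1 : s1 < s) :
    q s ≤ ψ0 * exp (-2 * s) / 2 := by
  have h := le_of_hasDerivAt_nonneg_of_tendsto
    (f := fun t => q t - ψ0 * exp (-2 * t) / 2) (L := 0 - ψ0 * 0 / 2)
    (fun r hr => (T.hp r (h1.trans_le hr)).sub
      ((((hasDerivAt_id r).const_mul (-2)).exp.const_mul ψ0).div_const 2))
    (fun r hr => by
      have := mul_nonneg (exp_pos (-2 * r)).le (sub_nonneg.2 (T.W_le (h1.trans_le hr)))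
      simp at this ⊢
      linarith)
    (T.p_top.sub (((tendsto_exp_atBot.comp
      ((tendsto_id).const_mul_atTop_of_neg (by norm_num))).const_mul ψ0).div_const 2))
  simp at h
  simpa using h

lemma hasDerivAt_exp_neg_two (c s : ℝ) :
    HasDerivAt (fun t => c * exp (-2 * t) / 2) (-(c * exp (-2 * s))) s := by
  refine ((((hasDerivAt_id s).const_mul (-2)).exp.const_mul c).div_const 2).congr_deriv ?_
  simp only [id, mul_one]
  ring

lemma abs_wronskian_le (S : LogSol g s0 γ W p A E) (T : LogSol (fun _ => 1) s1 ψ0 Ψ q B E1)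
    {τ η s : ℝ} (hη : ∀ t, 0 ≤ t → t ≤ W τ → |g t - 1| ≤ η)
    (h0 : s0 < s) (h1 : s1 < s) (hs : s ≤ τ) :
    |p s * Ψ s - W s * q s| ≤
      |p τ * Ψ τ - W τ * q τ| + η * W τ * ψ0 * exp (-2 * s) / 2 := by
  have hη0 : 0 ≤ η := (abs_nonneg _).trans (hη 0 le_rfl (S.pos τ (h0.trans_le hs)).le)
  have h := abs_sub_le_of_abs_deriv_le hs
    (fun t ht => S.hasDerivAt_wronskian T (h0.trans_le ht.1) (h1.trans_le ht.1))
    (fun t _ => hasDerivAt_exp_neg_two (η * W τ * ψ0) t)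
    (fun t ht => by
      have i0 := h0.trans_le ht.1
      have i1 := h1.trans_le ht.1
      have hW0 := S.pos t i0
      have hΨ0 := T.pos t i1
      have hWt := S.W_mono i0 ht.2
      have hΨt := T.W_le i1
      have hgt : |1 - g (W t)| ≤ η := by rw [abs_sub_comm]; exact hη _ hW0.le hWt
      rw [abs_mul, abs_of_pos (by positivity : 0 < exp (-2 * t) * (W t * Ψ t))]
      calc exp (-2 * t) * (W t * Ψ t) * |1 - g (W t)| ≤ exp (-2 * t) * (W τ * ψ0) * η := by
            have := hW0.le.trans hWt
            have := T.top_pos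
            gcongr
        _ = _ := by ring)
  have h2 : 0 ≤ η * W τ * ψ0 * exp (-2 * τ) / 2 := by
    have := (S.pos τ (h0.trans_le hs)).le
    have := T.top_pos
    positivity
  have h3 := abs_sub_abs_le_abs_sub (p s * Ψ s - W s * q s) (p τ * Ψ τ - W τ * q τ)
  linarith

lemma abs_quotient_sub_le (S : LogSol g s0 γ W p A E) (T : LogSol (fun _ => 1) s1 ψ0 Ψ q B E1)
    {τ η M s : ℝ} (hη : ∀ t, 0 ≤ t → t ≤ W τ → |g t - 1| ≤ η)
    (h0 : s0 < s) (h1 : s1 < M) (hM : M ≤ s) (hs : s ≤ τ) :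
    |W s / Ψ s - W τ / Ψ τ| ≤ (|p τ * Ψ τ - W τ * q τ| * (τ - M) +
      η * W τ * ψ0 * exp (-2 * M) / 4) / Ψ M ^ 2 := by
  have hη0 : 0 ≤ η := (abs_nonneg _).trans (hη 0 le_rfl (S.pos τ (h0.trans_le hs)).le)
  have hm := T.pos M h1
  have hWτ := S.pos τ (h0.trans_le hs)
  have hψ := T.top_pos
  set ω := |p τ * Ψ τ - W τ * q τ| with hω
  have hω0 : 0 ≤ ω := abs_nonneg _
  have h := abs_sub_le_of_abs_deriv_le hs
    (fun t ht => S.hasDerivAt_quotient T (h0.trans_le ht.1) (h1.trans_le (hM.trans ht.1)))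
    (k := fun t => (-(ω * t) + (η * W τ * ψ0 / 2) * exp (-2 * t) / 2) / Ψ M ^ 2)
    (fun t _ => ((((hasDerivAt_id t).const_mul ω).neg).add
      (hasDerivAt_exp_neg_two (η * W τ * ψ0 / 2) t)).div_const (Ψ M ^ 2))
    (fun t ht => by
      have i0 := h0.trans_le ht.1
      have i1 := h1.trans_le (hM.trans ht.1)
      have hΨ0 := T.pos t i1
      have hΨM := T.W_mono h1 (hM.trans ht.1)
      have hw := S.abs_wronskian_le T hη i0 i1 ht.2
      rw [abs_div, abs_of_pos (by positivity : 0 < Ψ t ^ 2)]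
      calc |p t * Ψ t - W t * q t| / Ψ t ^ 2 ≤
            (ω + η * W τ * ψ0 * exp (-2 * t) / 2) / Ψ M ^ 2 := by gcongr
        _ = _ := by ring)
  refine h.trans ?_
  rw [← sub_div]
  apply div_le_div_of_nonneg_right _ (by positivity)
  have e1 : exp (-2 * s) ≤ exp (-2 * M) := exp_le_exp.2 (by linarith)
  have e2 : η * W τ * ψ0 * exp (-2 * s) ≤ η * W τ * ψ0 * exp (-2 * M) := by gcongr
  have e3 : 0 ≤ η * W τ * ψ0 * exp (-2 * τ) := by positivity
  have e4 : ω * M ≤ ω * s := mul_le_mul_of_nonneg_left hM hω0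
  linarith

/-- The energy close to the boundary is small. -/
lemma energy_le (S : LogSol g s0 γ W p A E) {M : ℝ} (hM : s0 < M)
    (hg : ∀ t, 0 ≤ t → t ≤ W M → g t ≤ 2) :
    E ≤ A M + W M ^ 2 * exp (-2 * M + 2 * (W M / p M)) := by
  refine le_of_tendsto S.A_bot ?_
  filter_upwards [Ioo_mem_nhdsGT hM] with s hs
  have hpM := S.p_pos hM
  have h1 := S.W_le_tangent hs.1 hs.2.le
  have h2 : M - s ≤ W M / p M := by
    rw [le_div_iff₀ hpM]
    have := S.pos s hs.1
    linarith
  have h3 := le_of_hasDerivAt_nonneg (f := fun t => A t - (2 * W M ^ 2) * exp (-2 * t) / 2)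
    hs.2.le
    (fun t ht => (S.hA t (hs.1.trans_le ht.1)).sub (hasDerivAt_exp_neg_two (2 * W M ^ 2) t))
    (fun t ht => by
      have i0 := hs.1.trans_le ht.1
      have hWt := S.W_mono i0 ht.2
      have hWt0 := S.pos t i0
      have hgt := hg (W t) hWt0.le hWt
      have hgt0 := S.gpos t i0
      have : exp (-2 * t) * (W t * g (W t)) * W t ≤ 2 * W M ^ 2 * exp (-2 * t) := by
        calc _ ≤ exp (-2 * t) * (W M * 2) * W M := by
              have := hWt0.le.trans hWt
              gcongr
          _ = _ := by ring
      linarith)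
  have h4 : exp (-2 * s) ≤ exp (-2 * M + 2 * (W M / p M)) := exp_le_exp.2 (by linarith)
  have h5 := mul_le_mul_of_nonneg_left h4 (sq_nonneg (W M))
  have h6 : 0 ≤ W M ^ 2 * exp (-2 * M) := by positivity
  linarith

lemma A_le_energy (S : LogSol g s0 γ W p A E) {M : ℝ} (hM : s0 < M) : A M ≤ E := by
  refine ge_of_tendsto S.A_bot ?_
  filter_upwards [Ioo_mem_nhdsGT hM] with s hs
  exact S.A_anti hs.1 hs.2.le

end LogSol

/-- A family of solutions which, far from the boundary, has height close to `h`, small slope, and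
energy close to `α` above that height. Here `g = 1` on `[0, h]`, and `Ψ` is a positive solution of
the linear equation. -/
structure LimitFamily {ι : Type*} (l : Filter ι) (g : ℝ → ℝ) (h α : ℝ) (s0 γ : ι → ℝ)
    (W p A : ι → ℝ → ℝ) (E τ : ι → ℝ) (s1 ψ0 : ℝ) (Ψ q B : ℝ → ℝ) (E1 : ℝ) : Prop where
  cont : ContinuousOn g (Ici 0)
  one : ∀ t ∈ Icc 0 h, g t = 1
  h_pos : 0 < h
  sol : ∀ i, LogSol g (s0 i) (γ i) (W i) (p i) (A i) (E i)
  lin : LogSol (fun _ => 1) s1 ψ0 Ψ q B E1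
  lt : ∀ i, s0 i < τ i
  τ_top : Tendsto τ l atTop
  height : Tendsto (fun i => W i (τ i)) l (𝓝 h)
  slope : Tendsto (fun i => p i (τ i) * τ i) l (𝓝 0)
  energy : Tendsto (fun i => A i (τ i)) l (𝓝 α)

namespace LimitFamily

variable {ι : Type*} {l : Filter ι} {g : ℝ → ℝ} {h α : ℝ} {s0 γ : ι → ℝ}
    {W p A : ι → ℝ → ℝ} {E τ : ι → ℝ} {s1 ψ0 : ℝ} {Ψ q B : ℝ → ℝ} {E1 : ℝ}

lemma eventually_abs_sub_one_le (H : LimitFamily l g h α s0 γ W p A E τ s1 ψ0 Ψ q B E1) {η : ℝ}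
    (hη : 0 < η) : ∀ᶠ i in l, ∀ t, 0 ≤ t → t ≤ W i (τ i) → |g t - 1| ≤ η := by
  have hc := H.cont h H.h_pos.le
  rw [Metric.continuousWithinAt_iff] at hc
  obtain ⟨ρ, hρ, hc⟩ := hc η hη
  filter_upwards [H.height.eventually (gt_mem_nhds (show h < h + ρ by linarith))] with i hi t h0 ht
  rcases le_or_gt t h with h1 | h1
  · rw [H.one t ⟨h0, h1⟩]; simpa using hη.le
  · have := hc (x := t) h0 (by rw [Real.dist_eq, abs_lt]; constructor <;> linarith)
    rw [H.one h ⟨H.h_pos.le, le_rfl⟩, Real.dist_eq] at this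
    exact this.le

lemma tendsto_wronskian (H : LimitFamily l g h α s0 γ W p A E τ s1 ψ0 Ψ q B E1) :
    Tendsto (fun i => |p i (τ i) * Ψ (τ i) - W i (τ i) * q (τ i)| * τ i) l (𝓝 0) := by
  have h1 : Tendsto (fun i => Ψ (τ i)) l (𝓝 ψ0) := H.lin.W_top.comp H.τ_top
  have h2 : Tendsto (fun i => q (τ i) * τ i) l (𝓝 0) := by
    have h3 : Tendsto (fun s => ψ0 * exp (-2 * s) / 2 * s) atTop (𝓝 0) := by
      have h4 : Tendsto (fun s : ℝ => 2 * s) atTop atTop :=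
        tendsto_id.const_mul_atTop (by norm_num)
      have h5 := ((tendsto_pow_mul_exp_neg_atTop_nhds_zero 1).comp h4).const_mul (ψ0 / 4)
      rw [mul_zero] at h5
      refine h5.congr fun s => ?_
      simp only [Function.comp, pow_one]
      rw [neg_mul]
      ring
    have h4 : Tendsto (fun s => q s * s) atTop (𝓝 0) := by
      refine tendsto_of_tendsto_of_tendsto_of_le_of_le' tendsto_const_nhds h3 ?_ ?_
      · filter_upwards [eventually_gt_atTop s1, eventually_ge_atTop 0] with s hs hs0
        exact mul_nonneg (H.lin.p_pos hs).le hs0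
      · filter_upwards [eventually_gt_atTop s1, eventually_ge_atTop 0] with s hs hs0
        exact mul_le_mul_of_nonneg_right (H.lin.linear_slope_le hs) hs0
    exact h4.comp H.τ_top
  have h3 := ((H.slope.mul h1).sub (H.height.mul h2)).abs
  simp only [zero_mul, mul_zero, sub_zero, abs_zero] at h3
  refine h3.congr' ?_
  filter_upwards [H.τ_top.eventually_ge_atTop 0] with i hi
  rw [← abs_of_nonneg hi, ← abs_mul, abs_of_nonneg hi]
  congr 1
  ring

lemma eventually_close (H : LimitFamily l g h α s0 γ W p A E τ s1 ψ0 Ψ q B E1) {M ε : ℝ}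
    (hM : s1 < M) (hε : 0 < ε) : ∀ᶠ i in l, M < τ i ∧ ∀ s, s0 i < s → M ≤ s → s ≤ τ i →
      |W i s / Ψ s - h / ψ0| ≤ ε ∧ |p i s * Ψ s - W i s * q s| ≤ ε := by
  have hψ := H.lin.top_pos
  have hm := H.lin.pos M hM
  set K := (h + 1) * ψ0 * exp (-2 * M) with hK
  have hK0 : 0 < K := by have := H.h_pos; positivity
  -- a small bound for `g - 1`
  obtain ⟨η, hη, hη1, hη2⟩ : ∃ η : ℝ, 0 < η ∧ η * K ≤ ε ∧ η * K / Ψ M ^ 2 ≤ ε := by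
    refine ⟨min (ε / K) (ε * Ψ M ^ 2 / K), by positivity, ?_, ?_⟩
    · exact (le_div_iff₀ hK0).1 (min_le_left _ _)
    · rw [div_le_iff₀ (by positivity)]
      exact (le_div_iff₀ hK0).1 (min_le_right _ _)
  have hw := H.tendsto_wronskian
  have t1 : Tendsto (fun i => |p i (τ i) * Ψ (τ i) - W i (τ i) * q (τ i)|) l (𝓝 0) := by
    refine tendsto_of_tendsto_of_tendsto_of_le_of_le' tendsto_const_nhds hw ?_ ?_
    · exact Eventually.of_forall fun i => abs_nonneg _
    · filter_upwards [H.τ_top.eventually_ge_atTop 1] with i hi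
      exact le_mul_of_one_le_right (abs_nonneg _) hi
  have t2 : Tendsto (fun i => |p i (τ i) * Ψ (τ i) - W i (τ i) * q (τ i)| * (τ i - M) / Ψ M ^ 2)
      l (𝓝 0) := by
    have := (hw.sub (t1.mul_const M)).div_const (Ψ M ^ 2)
    simp only [zero_mul, sub_zero, zero_div] at this
    refine this.congr fun i => ?_
    ring
  have t3 : Tendsto (fun i => |W i (τ i) / Ψ (τ i) - h / ψ0|) l (𝓝 0) := by
    have := ((H.height.div (H.lin.W_top.comp H.τ_top) hψ.ne').sub_const (h / ψ0)).abs
    simpa using this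
  filter_upwards [H.τ_top.eventually_gt_atTop M, H.eventually_abs_sub_one_le hη,
    t1.eventually (gt_mem_nhds (half_pos hε)), t2.eventually (gt_mem_nhds (half_pos hε)),
    t3.eventually (gt_mem_nhds (show 0 < ε / 4 by positivity)),
    H.height.eventually (gt_mem_nhds (show h < h + 1 by linarith))] with i i1 i2 i3 i4 i5 i6
  refine ⟨i1, fun s hs hMs hsτ => ⟨?_, ?_⟩⟩
  · have l1 := (H.sol i).abs_quotient_sub_le H.lin i2 hs hM hMs hsτ
    have l2 : η * W i (τ i) * ψ0 * exp (-2 * M) / 4 / Ψ M ^ 2 ≤ ε / 4 := by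
      have := H.h_pos
      calc _ ≤ η * (h + 1) * ψ0 * exp (-2 * M) / 4 / Ψ M ^ 2 := by gcongr
        _ = (η * K / Ψ M ^ 2) / 4 := by rw [hK]; ring
        _ ≤ _ := by gcongr
    rw [add_div] at l1
    have l3 := abs_sub_le (W i s / Ψ s) (W i (τ i) / Ψ (τ i)) (h / ψ0)
    linarith
  · have l1 := (H.sol i).abs_wronskian_le H.lin i2 hs (hM.trans_le hMs) hsτ
    have e1 : exp (-2 * s) ≤ exp (-2 * M) := exp_le_exp.2 (by linarith)
    have := H.h_pos
    have l2 : η * W i (τ i) * ψ0 * exp (-2 * s) / 2 ≤ ε / 2 := by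
      calc _ ≤ η * (h + 1) * ψ0 * exp (-2 * s) / 2 := by gcongr
        _ ≤ η * (h + 1) * ψ0 * exp (-2 * M) / 2 :=
          div_le_div_of_nonneg_right (mul_le_mul_of_nonneg_left e1 (by positivity)) (by norm_num)
        _ = (η * K) / 2 := by rw [hK]; ring
        _ ≤ _ := by gcongr
    linarith

lemma eventually_lt (H : LimitFamily l g h α s0 γ W p A E τ s1 ψ0 Ψ q B E1) {M : ℝ}
    (hM : s1 < M) : ∀ᶠ i in l, s0 i < M := by
  have hψ := H.lin.top_pos
  have hh := H.h_pos
  have hm := H.lin.pos M hM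
  filter_upwards [H.eventually_close hM (show 0 < h / ψ0 / 2 by positivity)] with i hi
  by_contra! hcon
  have h1 : h / ψ0 / 2 * Ψ M ≤ 0 := by
    refine ge_of_tendsto (H.sol i).W_bot ?_
    filter_upwards [Ioo_mem_nhdsGT (H.lt i)] with s hs
    have h2 := (abs_le.1 (hi.2 s hs.1 (hcon.trans hs.1.le) hs.2.le).1).1
    have h3 : Ψ M ≤ Ψ s := H.lin.W_mono hM (hcon.trans hs.1.le)
    have h4 : h / ψ0 / 2 ≤ W i s / Ψ s := by linarith
    rw [le_div_iff₀ (hm.trans_le h3)] at h4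
    exact (mul_le_mul_of_nonneg_left h3 (by positivity)).trans h4
  have : 0 < h / ψ0 / 2 * Ψ M := by positivity
  linarith

lemma tendsto_height (H : LimitFamily l g h α s0 γ W p A E τ s1 ψ0 Ψ q B E1) {M : ℝ}
    (hM : s1 < M) : Tendsto (fun i => W i M) l (𝓝 (h / ψ0 * Ψ M)) := by
  have h1 : Tendsto (fun i => W i M / Ψ M) l (𝓝 (h / ψ0)) := by
    rw [Metric.tendsto_nhds]
    intro ε hε
    filter_upwards [H.eventually_close hM (half_pos hε), H.eventually_lt hM] with i hi hi2
    rw [Real.dist_eq]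
    have := (hi.2 M hi2 le_rfl hi.1.le).1
    linarith
  refine (h1.mul_const (Ψ M)).congr fun i => ?_
  exact div_mul_cancel₀ _ (H.lin.pos M hM).ne'

lemma tendsto_slope (H : LimitFamily l g h α s0 γ W p A E τ s1 ψ0 Ψ q B E1) {M : ℝ}
    (hM : s1 < M) : Tendsto (fun i => p i M) l (𝓝 (h / ψ0 * q M)) := by
  have hm := (H.lin.pos M hM).ne'
  have h1 : Tendsto (fun i => p i M * Ψ M - W i M * q M) l (𝓝 0) := by
    rw [Metric.tendsto_nhds]
    intro ε hε
    filter_upwards [H.eventually_close hM (half_pos hε), H.eventually_lt hM] with i hi hi2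
    rw [Real.dist_eq, sub_zero]
    have := (hi.2 M hi2 le_rfl hi.1.le).2
    linarith
  have h2 := (h1.add ((H.tendsto_height hM).mul_const (q M))).div_const (Ψ M)
  have e : (0 + h / ψ0 * Ψ M * q M) / Ψ M = h / ψ0 * q M := by field_simp; ring
  rw [e] at h2
  refine h2.congr fun i => ?_
  rw [sub_add_cancel, mul_div_cancel_right₀ _ hm]

lemma tendsto_A (H : LimitFamily l g h α s0 γ W p A E τ s1 ψ0 Ψ q B E1) {M : ℝ}
    (hM : s1 < M) : Tendsto (fun i => A i M) l (𝓝 (α + (h / ψ0) ^ 2 * B M)) := by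
  have hψ := H.lin.top_pos
  have hh := H.h_pos
  set c := h / ψ0 with hc
  have hc0 : 0 < c := by positivity
  have h1 : Tendsto (fun i => A i M - A i (τ i) - (c ^ 2 * B M - c ^ 2 * B (τ i))) l (𝓝 0) := by
    rw [Metric.tendsto_nhds]
    intro ε hε
    set K := ((h + 1) ^ 2 + ψ0 ^ 2 * (2 * c + 1)) * exp (-2 * M) with hK
    have hK0 : 0 < K := by positivity
    obtain ⟨η, hη, hη1, hη2⟩ : ∃ η : ℝ, 0 < η ∧ η * K ≤ ε ∧ η ≤ 1 :=
      ⟨min (ε / K) 1, by positivity, (le_div_iff₀ hK0).1 (min_le_left _ _), min_le_right _ _⟩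
    filter_upwards [H.eventually_close hM hη, H.eventually_lt hM, H.eventually_abs_sub_one_le hη,
      H.height.eventually (gt_mem_nhds (show h < h + 1 by linarith))] with i i1 i2 i3 i4
    rw [Real.dist_eq, sub_zero]
    have S := H.sol i
    have T := H.lin
    have l1 := abs_sub_le_of_abs_deriv_le (f := fun s => A i s - c ^ 2 * B s) i1.1.le
      (fun t ht => (S.hA t (i2.trans_le ht.1)).sub
        ((T.hA t (hM.trans_le ht.1)).const_mul (c ^ 2)))
      (fun t _ => LogSol.hasDerivAt_exp_neg_two
        (η * ((h + 1) ^ 2 + ψ0 ^ 2 * (2 * c + 1))) t)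
      (fun t ht => by
        have j0 := i2.trans_le ht.1
        have j1 := hM.trans_le ht.1
        have hW0 := S.pos t j0
        have hWt : W i t ≤ h + 1 := (S.W_mono j0 ht.2).trans i4.le
        have hΨ0 := T.pos t j1
        have hΨt := T.W_le j1
        have m1 := i3 (W i t) hW0.le (S.W_mono j0 ht.2)
        have m2 := (i1.2 t j0 ht.1 ht.2).1
        have m3 : |W i t ^ 2 * (g (W i t) - 1)| ≤ (h + 1) ^ 2 * η := by
          rw [abs_mul, abs_of_nonneg (sq_nonneg _)]
          gcongr
        have m4 : |W i t ^ 2 - c ^ 2 * Ψ t ^ 2| ≤ ψ0 ^ 2 * (2 * c + 1) * η := by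
          have e : W i t ^ 2 - c ^ 2 * Ψ t ^ 2 =
              Ψ t ^ 2 * ((W i t / Ψ t - c) + 2 * c) * (W i t / Ψ t - c) := by
            field_simp; ring
          rw [e, abs_mul, abs_mul, abs_of_nonneg (sq_nonneg (Ψ t))]
          have m5 : |W i t / Ψ t - c + 2 * c| ≤ 2 * c + 1 := by
            refine (abs_add_le _ _).trans ?_
            rw [abs_of_pos (show 0 < 2 * c by positivity)]
            linarith
          gcongr
        have e : -(exp (-2 * t) * (W i t * g (W i t)) * W i t) -
            c ^ 2 * -(exp (-2 * t) * (Ψ t * 1) * Ψ t) =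
            -(exp (-2 * t) * (W i t ^ 2 * (g (W i t) - 1) + (W i t ^ 2 - c ^ 2 * Ψ t ^ 2))) := by
          ring
        rw [e, abs_neg, abs_mul, abs_of_pos (exp_pos _), neg_neg, mul_comm]
        gcongr
        refine (abs_add_le _ _).trans ?_
        linarith)
    have l2 : 0 < η * ((h + 1) ^ 2 + ψ0 ^ 2 * (2 * c + 1)) * exp (-2 * τ i) / 2 := by positivity
    have l3 : η * ((h + 1) ^ 2 + ψ0 ^ 2 * (2 * c + 1)) * exp (-2 * M) / 2 = η * K / 2 := by
      rw [hK]; ring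
    have e : A i M - A i (τ i) - (c ^ 2 * B M - c ^ 2 * B (τ i)) =
      A i M - c ^ 2 * B M - (A i (τ i) - c ^ 2 * B (τ i)) := by ring
    rw [e]
    linarith
  have h2 := (h1.add H.energy).add
    ((((H.lin.A_top.comp H.τ_top).const_mul (c ^ 2)).const_sub (c ^ 2 * B M)))
  have e : 0 + α + (c ^ 2 * B M - c ^ 2 * 0) = α + c ^ 2 * B M := by ring
  rw [e] at h2
  refine h2.congr fun i => ?_
  simp only [Function.comp]
  ring

/-- Convergence of the total energy. -/
lemma tendsto_energy (H : LimitFamily l g h α s0 γ W p A E τ s1 ψ0 Ψ q B E1) :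
    Tendsto E l (𝓝 (α + (h / ψ0) ^ 2 * E1)) := by
  have hψ := H.lin.top_pos
  have hh := H.h_pos
  set c := h / ψ0 with hc
  have hc0 : 0 < c := by positivity
  rw [Metric.tendsto_nhds]
  intro ε hε
  -- choice of a point close to the boundary of the limit problem
  have hq1 : 0 < q (s1 + 1) := H.lin.p_pos (by linarith)
  have t1 : Tendsto (fun M => c ^ 2 * B M) (𝓝[>] s1) (𝓝 (c ^ 2 * E1)) :=
    H.lin.A_bot.const_mul _
  have t2 : Tendsto (fun M => (c * Ψ M) ^ 2 * exp (-2 * s1 + 2 * (Ψ M / q (s1 + 1))))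
      (𝓝[>] s1) (𝓝 0) := by
    have := ((H.lin.W_bot.const_mul c).pow 2).mul
      ((((H.lin.W_bot.div_const (q (s1 + 1))).const_mul 2).const_add (-2 * s1)).rexp)
    simpa using this
  obtain ⟨M, ⟨hM1, hM2⟩, hM3, hM4⟩ := ((show ∀ᶠ M in 𝓝[>] s1, M ∈ Ioo s1 (s1 + 1) from
    Ioo_mem_nhdsGT (by linarith)).and ((t1.eventually (Metric.ball_mem_nhds _
      (show 0 < ε / 4 by positivity))).and
    (t2.eventually (gt_mem_nhds (show 0 < ε / 4 by positivity))))).exists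
  rw [Real.dist_eq, abs_lt] at hM3
  have hqM : 0 < q M := H.lin.p_pos hM1
  have hqM1 : q (s1 + 1) ≤ q M := H.lin.p_anti hM1 hM2.le
  have hΨM := H.lin.pos M hM1
  have hM5 : (c * Ψ M) ^ 2 * exp (-2 * M + 2 * (c * Ψ M / (c * q M))) < ε / 4 := by
    refine lt_of_le_of_lt ?_ hM4
    rw [mul_div_mul_left _ _ hc0.ne']
    have h1 : Ψ M / q M ≤ Ψ M / q (s1 + 1) := by gcongr
    have h2 : exp (-2 * M + 2 * (Ψ M / q M)) ≤ exp (-2 * s1 + 2 * (Ψ M / q (s1 + 1))) :=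
      exp_le_exp.2 (by linarith)
    exact mul_le_mul_of_nonneg_left h2 (sq_nonneg _)
  have t3 : Tendsto (fun i => W i M ^ 2 * exp (-2 * M + 2 * (W i M / p i M))) l
      (𝓝 ((c * Ψ M) ^ 2 * exp (-2 * M + 2 * (c * Ψ M / (c * q M))))) :=
    ((H.tendsto_height hM1).pow 2).mul
      (((((H.tendsto_height hM1).div (H.tendsto_slope hM1) (by positivity)).const_mul 2).const_add
        (-2 * M)).rexp)
  filter_upwards [H.eventually_lt hM1, H.eventually_abs_sub_one_le one_pos,
    t3.eventually (gt_mem_nhds hM5),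
    (H.tendsto_A hM1).eventually (Metric.ball_mem_nhds _ (show 0 < ε / 4 by positivity)),
    H.τ_top.eventually_ge_atTop M] with i i1 i2 i3 i4 i5
  rw [Real.dist_eq, abs_lt] at i4
  have l1 := (H.sol i).A_le_energy i1
  have l2 := (H.sol i).energy_le i1 (fun t h0 ht => by
    have := (abs_le.1 (i2 t h0 (ht.trans ((H.sol i).W_mono i1 i5)))).2
    linarith)
  rw [Real.dist_eq, abs_lt]
  constructor <;> linarith

end LimitFamily

/-- A smooth positive radial solution of `Δu = β u g(u)` on the unit disk with zero boundary
values. -/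
structure RadialSol (g : ℝ → ℝ) (β : ℝ) (u : ℝ → ℝ) : Prop where
  β_pos : 0 < β
  g_cont : ContinuousOn g (Ici 0)
  g_pos : ∀ t, 0 ≤ t → 0 < g t
  smooth : ContDiffOn ℝ (⊤ : ℕ∞) u (Icc 0 1)
  eq : ∀ r ∈ Ioo (0 : ℝ) 1, radLap u r = β * u r * g (u r)
  pos : ∀ r ∈ Ico (0 : ℝ) 1, 0 < u r
  bdry : u 1 = 0

namespace RadialSol

variable {g : ℝ → ℝ} {β : ℝ} {u : ℝ → ℝ}

/-- The flux `-r u'`, extended continuously to `[0, 1]`. -/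
def flux (u : ℝ → ℝ) (r : ℝ) : ℝ := -(r * derivWithin u (Icc 0 1) r)

/-- The energy density `β r u² g(u)`. -/
def density (g : ℝ → ℝ) (β : ℝ) (u : ℝ → ℝ) (r : ℝ) : ℝ := β * r * u r ^ 2 * g (u r)

lemma nonneg (S : RadialSol g β u) {r : ℝ} (hr : r ∈ Icc (0 : ℝ) 1) : 0 ≤ u r := by
  rcases hr.2.lt_or_eq with h | h
  · exact (S.pos r ⟨hr.1, h⟩).le
  · rw [h, S.bdry]

lemma continuousOn (S : RadialSol g β u) : ContinuousOn u (Icc 0 1) := S.smooth.continuousOn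

lemma continuousOn_derivWithin (S : RadialSol g β u) :
    ContinuousOn (derivWithin u (Icc 0 1)) (Icc 0 1) :=
  S.smooth.continuousOn_derivWithin (uniqueDiffOn_Icc zero_lt_one) (by simp)

lemma derivWithin_eq (u : ℝ → ℝ) {r : ℝ} (hr : r ∈ Ioo (0 : ℝ) 1) :
    derivWithin u (Icc 0 1) r = deriv u r :=
  derivWithin_of_mem_nhds (Icc_mem_nhds hr.1 hr.2)

lemma hasDerivAt (S : RadialSol g β u) {r : ℝ} (hr : r ∈ Ioo (0 : ℝ) 1) :
    HasDerivAt u (derivWithin u (Icc 0 1) r) r := by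
  rw [derivWithin_eq u hr]
  exact ((S.smooth.contDiffAt (Icc_mem_nhds hr.1 hr.2)).differentiableAt (by simp)).hasDerivAt

lemma hasDerivAt_flux (S : RadialSol g β u) {r : ℝ} (hr : r ∈ Ioo (0 : ℝ) 1) :
    HasDerivAt (flux u) (r * (β * u r * g (u r))) r := by
  have h1 : HasDerivAt (deriv u) (deriv (deriv u) r) r := by
    have h2 : ContDiffOn ℝ 1 (deriv u) (Ioo 0 1) :=
      (S.smooth.mono Ioo_subset_Icc_self).deriv_of_isOpen isOpen_Ioo
        (WithTop.coe_le_coe.2 (le_top : (1 + 1 : ℕ∞) ≤ ⊤))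
    exact ((h2.contDiffAt (Ioo_mem_nhds hr.1 hr.2)).differentiableAt (by simp)).hasDerivAt
  have h3 : HasDerivAt (fun t => -(t * deriv u t)) (r * (β * u r * g (u r))) r := by
    refine ((hasDerivAt_id r).mul h1).neg.congr_deriv ?_
    rw [← S.eq r hr, radLap]
    have := hr.1.ne'
    simp only [id]
    field_simp
    ring
  refine h3.congr_of_eventuallyEq ?_
  filter_upwards [Ioo_mem_nhds hr.1 hr.2] with t ht
  rw [flux, derivWithin_eq u ht]

lemma continuousOn_flux (S : RadialSol g β u) : ContinuousOn (flux u) (Icc 0 1) :=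
  (continuousOn_id.mul S.continuousOn_derivWithin).neg

lemma continuousOn_density (S : RadialSol g β u) : ContinuousOn (density g β u) (Icc 0 1) :=
  ((continuousOn_const.mul continuousOn_id).mul (S.continuousOn.pow 2)).mul
    (S.g_cont.comp S.continuousOn fun _ hr => S.nonneg hr)

lemma continuousOn_primitive (S : RadialSol g β u) :
    ContinuousOn (fun r => ∫ t in (0 : ℝ)..r, density g β u t) (Icc 0 1) := by
  have h : IntegrableOn (density g β u) (uIcc 0 1) := by
    rw [uIcc_of_le zero_le_one]
    exact S.continuousOn_density.integrableOn_Icc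
  have := intervalIntegral.continuousOn_primitive_interval h
  rwa [uIcc_of_le zero_le_one] at this

lemma hasDerivAt_primitive (S : RadialSol g β u) {r : ℝ} (hr : r ∈ Ioo (0 : ℝ) 1) :
    HasDerivAt (fun r => ∫ t in (0 : ℝ)..r, density g β u t) (density g β u r) r := by
  apply intervalIntegral.integral_hasDerivAt_right
  · apply ContinuousOn.intervalIntegrable
    rw [uIcc_of_le hr.1.le]
    exact S.continuousOn_density.mono (Icc_subset_Icc_right hr.2.le)
  · exact (S.continuousOn_density.mono Ioo_subset_Icc_self).stronglyMeasurableAtFilter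
      isOpen_Ioo r hr
  · exact S.continuousOn_density.continuousAt (Icc_mem_nhds hr.1 hr.2)

/-- Passing to the logarithmic variable `s = -log (√β r)`. -/
lemma logSol (S : RadialSol g β u) :
    LogSol g (-log β / 2) (u 0) (fun s => u (exp (-log β / 2 - s)))
      (fun s => flux u (exp (-log β / 2 - s)))
      (fun s => ∫ t in (0 : ℝ)..exp (-log β / 2 - s), density g β u t)
      (∫ t in (0 : ℝ)..1, density g β u t) := by
  set s0 := -log β / 2 with hs0
  have hρ : ∀ s, s0 < s → exp (s0 - s) ∈ Ioo (0 : ℝ) 1 := fun s hs =>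
    ⟨exp_pos _, by rw [exp_lt_one_iff]; linarith⟩
  have hρ' : ∀ s, HasDerivAt (fun t => exp (s0 - t)) (-exp (s0 - s)) s := fun s => by
    refine ((hasDerivAt_id s).const_sub s0).exp.congr_deriv ?_
    simp
  have hexp : ∀ s, exp (-2 * s) = β * exp (s0 - s) ^ 2 := fun s => by
    rw [← exp_nat_mul]
    calc exp (-2 * s) = exp (log β + (2 : ℕ) * (s0 - s)) := by
          congr 1
          rw [hs0]
          push_cast
          ring
      _ = _ := by rw [exp_add, exp_log S.β_pos]
  have htop : Tendsto (fun s => exp (s0 - s)) atTop (𝓝[Icc 0 1] 0) := by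
    rw [tendsto_nhdsWithin_iff]
    refine ⟨tendsto_exp_atBot.comp (tendsto_atBot_add_const_left _ s0 tendsto_neg_atTop_atBot), ?_⟩
    filter_upwards [eventually_gt_atTop s0] with s hs using Ioo_subset_Icc_self (hρ s hs)
  have hbot : Tendsto (fun s => exp (s0 - s)) (𝓝[>] s0) (𝓝[Icc 0 1] 1) := by
    rw [tendsto_nhdsWithin_iff]
    constructor
    · have := (hρ' s0).continuousAt.tendsto
      rw [sub_self, exp_zero] at this
      exact this.mono_left nhdsWithin_le_nhds
    · filter_upwards [self_mem_nhdsWithin] with s hs using Ioo_subset_Icc_self (hρ s hs)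
  have m0 : (0 : ℝ) ∈ Icc (0 : ℝ) 1 := by simp
  have m1 : (1 : ℝ) ∈ Icc (0 : ℝ) 1 := by simp
  refine ⟨fun s hs => ?_, fun s hs => ?_, fun s hs => ?_, fun s hs => ?_, fun s hs => ?_,
    ?_, ?_, ?_, ?_, ?_⟩
  · refine ((S.hasDerivAt (hρ s hs)).comp s (hρ' s)).congr_deriv ?_
    rw [flux]
    ring
  · refine ((S.hasDerivAt_flux (hρ s hs)).comp s (hρ' s)).congr_deriv ?_
    rw [hexp]
    ring
  · refine ((S.hasDerivAt_primitive (hρ s hs)).comp s (hρ' s)).congr_deriv ?_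
    rw [hexp, density]
    ring
  · exact S.pos _ (Ioo_subset_Ico_self (hρ s hs))
  · exact S.g_pos _ (S.nonneg (Ioo_subset_Icc_self (hρ s hs)))
  · exact (S.continuousOn 0 m0).tendsto.comp htop
  · have := (S.continuousOn_flux 0 m0).tendsto.comp htop
    rwa [show flux u 0 = 0 by simp [flux]] at this
  · have := (S.continuousOn_primitive 0 m0).tendsto.comp htop
    rwa [intervalIntegral.integral_same] at this
  · have := (S.continuousOn 1 m1).tendsto.comp hbot
    rwa [S.bdry] at this
  · exact (S.continuousOn_primitive 1 m1).tendsto.comp hbot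

/-- The energy identity `∫ |∇u|² = ∫ β u² g(u)`. -/
lemma dirEnergy_eq (S : RadialSol g β u) :
    dirEnergy u = 2 * π * ∫ t in (0 : ℝ)..1, density g β u t := by
  have hd : IntervalIntegrable (density g β u) volume 0 1 :=
    ContinuousOn.intervalIntegrable (by
      rw [uIcc_of_le zero_le_one]; exact S.continuousOn_density)
  have hw : IntervalIntegrable (fun r => r * derivWithin u (Icc 0 1) r ^ 2) volume 0 1 :=
    ContinuousOn.intervalIntegrable (by
      rw [uIcc_of_le zero_le_one]
      exact continuousOn_id.mul (S.continuousOn_derivWithin.pow 2))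
  have h1 := intervalIntegral.integral_eq_sub_of_hasDerivAt_of_le zero_le_one
    (S.continuousOn_flux.mul S.continuousOn)
    (f' := fun r => density g β u r - r * derivWithin u (Icc 0 1) r ^ 2)
    (fun r hr => by
      refine ((S.hasDerivAt_flux hr).mul (S.hasDerivAt hr)).congr_deriv ?_
      rw [density, flux]
      ring) (hd.sub hw)
  rw [intervalIntegral.integral_sub hd hw] at h1
  simp only [Pi.mul_apply, S.bdry, flux, zero_mul, mul_zero, neg_zero, sub_zero] at h1
  have h2 : dirEnergy u = ∫ r in Ioo (0 : ℝ) 1, 2 * π * (r * derivWithin u (Icc 0 1) r ^ 2) := by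
    refine setIntegral_congr_fun measurableSet_Ioo fun r hr => ?_
    rw [derivWithin_eq u hr]
    ring
  rw [h2, integral_const_mul, ← integral_Ioc_eq_integral_Ioo,
    ← intervalIntegral.integral_of_le zero_le_one]
  congr 1
  linarith

end RadialSol

/-- If `g = 1` in the range of a solution, the solution is a multiple of the linear one, with the
same eigenvalue. -/
lemma LogSol.eq_of_linear {g : ℝ → ℝ} {s0 γ : ℝ} {W p A : ℝ → ℝ} {E : ℝ} {s1 ψ0 : ℝ}
    {Ψ q B : ℝ → ℝ} {E1 : ℝ} (S : LogSol g s0 γ W p A E)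
    (T : LogSol (fun _ => 1) s1 ψ0 Ψ q B E1) (hg : ∀ t ∈ Icc 0 γ, g t = 1) :
    s0 = s1 ∧ ∀ s, s0 < s → W s = γ / ψ0 * Ψ s := by
  have hγ := S.top_pos
  have hψ := T.top_pos
  have hη : ∀ τ, s0 < τ → ∀ t, 0 ≤ t → t ≤ W τ → |g t - 1| ≤ 0 := fun τ hτ t h0 ht => by
    rw [hg t ⟨h0, ht.trans (S.W_le hτ)⟩]
    simp
  have hwr : ∀ s, s0 < s → s1 < s → |p s * Ψ s - W s * q s| = 0 := fun s h0 h1 => by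
    have ht : Tendsto (fun τ => |p τ * Ψ τ - W τ * q τ|) atTop (𝓝 0) := by
      simpa using ((S.p_top.mul T.W_top).sub (S.W_top.mul T.p_top)).abs
    refine le_antisymm (ge_of_tendsto ht ?_) (abs_nonneg _)
    filter_upwards [eventually_ge_atTop s] with τ hτ
    simpa using S.abs_wronskian_le T (hη τ (h0.trans_le hτ)) h0 h1 hτ
  have hW : ∀ s, s0 < s → s1 < s → W s = γ / ψ0 * Ψ s := fun s h0 h1 => by
    have ht : Tendsto (fun τ => W τ / Ψ τ) atTop (𝓝 (γ / ψ0)) := S.W_top.div T.W_top hψ.ne'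
    have h2 : W s / Ψ s = γ / ψ0 := by
      refine tendsto_nhds_unique ?_ ht
      refine tendsto_const_nhds.congr' ?_
      filter_upwards [eventually_ge_atTop s] with τ hτ
      have h3 := S.abs_quotient_sub_le T (hη τ (h0.trans_le hτ)) h0 h1 le_rfl hτ
      rw [hwr τ (h0.trans_le hτ) (h1.trans_le hτ)] at h3
      simp only [zero_mul, add_zero, zero_div] at h3
      exact sub_eq_zero.1 (abs_eq_zero.1 (le_antisymm h3 (abs_nonneg _)))
    rw [← h2, div_mul_cancel₀ _ (T.pos s h1).ne']
  have hc : 0 < γ / ψ0 := by positivity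
  have hs : s0 = s1 := by
    rcases lt_trichotomy s0 s1 with h | h | h
    · have h2 : Tendsto W (𝓝[>] s1) (𝓝 (W s1)) :=
        (S.hW s1 h).continuousAt.tendsto.mono_left nhdsWithin_le_nhds
      have h3 : Tendsto W (𝓝[>] s1) (𝓝 (γ / ψ0 * 0)) := by
        refine (T.W_bot.const_mul (γ / ψ0)).congr' ?_
        filter_upwards [self_mem_nhdsWithin] with s hs
        exact (hW s (h.trans hs) hs).symm
      have h4 := tendsto_nhds_unique h2 h3
      have := S.pos s1 h
      rw [mul_zero] at h4
      linarith
    · exact h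
    · have h2 : Tendsto (fun s => γ / ψ0 * Ψ s) (𝓝[>] s0) (𝓝 (γ / ψ0 * Ψ s0)) :=
        ((T.hW s0 h).continuousAt.tendsto.mono_left nhdsWithin_le_nhds).const_mul _
      have h3 : Tendsto (fun s => γ / ψ0 * Ψ s) (𝓝[>] s0) (𝓝 0) := by
        refine S.W_bot.congr' ?_
        filter_upwards [self_mem_nhdsWithin] with s hs
        exact hW s hs (h.trans hs)
      have h4 := tendsto_nhds_unique h2 h3
      have := mul_pos hc (T.pos s0 h)
      linarith
  exact ⟨hs, fun s h => hW s h (hs ▸ h)⟩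

lemma GCtx.exists_le {a c0 : ℝ} {g : ℝ → ℝ} (hG : GCtx a c0 g) :
    ∃ C, 0 < C ∧ ∀ t, 0 ≤ t → g t ≤ C * exp (t ^ 2 - a * t) := by
  obtain ⟨-, -, hc, -, hexp⟩ := hG
  have hcont : ContinuousOn (fun t => g t * exp (-(t ^ 2 - a * t))) (Icc 0 c0) :=
    (hc.mono Icc_subset_Ici_self).mul (by fun_prop)
  obtain ⟨C, hC⟩ := isCompact_Icc.exists_bound_of_continuousOn hcont
  refine ⟨max C 1, by positivity, fun t ht => ?_⟩
  rcases le_or_gt c0 t with h | h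
  · rw [hexp t h]
    exact le_mul_of_one_le_left (exp_pos _).le (le_max_right _ _)
  · have h1 := ((le_abs_self _).trans (hC t ⟨ht, h.le⟩)).trans (le_max_left C 1)
    rw [exp_neg, ← div_eq_mul_inv, div_le_iff₀ (exp_pos _)] at h1
    exact h1

/-- Convergence of the energy of solutions whose central value tends to infinity. -/
lemma tendsto_energy_of_logSol {g : ℝ → ℝ} {a c0 : ℝ} (hG : GCtx a c0 g)
    (hg1 : ∀ t ∈ Icc (0 : ℝ) (a / 2), g t = 1) {s0 : ℝ → ℝ} {W p A : ℝ → ℝ → ℝ} {E : ℝ → ℝ}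
    (hS : ∀ γ, 0 < γ → LogSol g (s0 γ) γ (W γ) (p γ) (A γ) (E γ)) {s1 ψ0 : ℝ} {Ψ q B : ℝ → ℝ}
    {E1 : ℝ} (T : LogSol (fun _ => 1) s1 ψ0 Ψ q B E1) :
    Tendsto E atTop (𝓝 (2 + (a / 2 / ψ0) ^ 2 * E1)) := by
  obtain ⟨C, hC0, hC⟩ := hG.exists_le
  obtain ⟨ha, -, hcont, -, hexp⟩ := hG
  rw [Metric.tendsto_nhds]
  intro ε hε
  by_contra hcon
  have hfr : ∃ᶠ γ in atTop, ¬ dist (E γ) (2 + (a / 2 / ψ0) ^ 2 * E1) < ε :=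
    not_eventually.1 hcon
  have hex : ∀ n : ℕ, ∃ γ r, (0 < γ ∧ ¬ dist (E γ) (2 + (a / 2 / ψ0) ^ 2 * E1) < ε) ∧
      s0 γ < r ∧ W γ r = a / 2 + 1 / ((n : ℝ) + 1) ∧ 1 / (1 / ((n : ℝ) + 1)) ≤ r ∧
      p γ r * r ≤ 4 * (1 / ((n : ℝ) + 1)) ∧ |A γ r - 2| ≤ 1 / ((n : ℝ) + 1) := fun n => by
    have hn : (1 : ℝ) / ((n : ℝ) + 1) ≤ 1 := by
      rw [div_le_one (by positivity)]
      have := n.cast_nonneg (α := ℝ)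
      linarith
    obtain ⟨γ, h1, h2, h3⟩ := (hfr.and_eventually
      ((eventually_neck ha hexp hC0 hC Nat.one_div_pos_of_nat hn).and
        (eventually_gt_atTop 0))).exists
    obtain ⟨r, hr⟩ := h2 _ _ _ _ _ (hS γ h3)
    exact ⟨γ, r, ⟨h3, h1⟩, hr⟩
  choose γ τ hγ hlt hheight hτ hslope hA using hex
  have hlim : Tendsto (fun n : ℕ => (1 : ℝ) / ((n : ℝ) + 1)) atTop (𝓝 0) :=
    tendsto_one_div_add_atTop_nhds_zero_nat
  have hτ1 : ∀ n : ℕ, (n : ℝ) + 1 ≤ τ n := fun n => by simpa using hτ n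
  have H : LimitFamily atTop g (a / 2) 2 (fun n => s0 (γ n)) γ (fun n => W (γ n))
      (fun n => p (γ n)) (fun n => A (γ n)) (fun n => E (γ n)) τ s1 ψ0 Ψ q B E1 :=
    { cont := hcont
      one := hg1
      h_pos := half_pos ha
      sol := fun n => hS _ (hγ n).1
      lin := T
      lt := hlt
      τ_top := tendsto_atTop_mono (fun n => (le_add_of_nonneg_right zero_le_one).trans (hτ1 n))
        tendsto_natCast_atTop_atTop
      height := by
        have := hlim.const_add (a / 2)
        rw [add_zero] at this
        exact this.congr fun n => (hheight n).symm
      slope := by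
        have := hlim.const_mul 4
        rw [mul_zero] at this
        refine squeeze_zero (fun n => ?_) hslope this
        have := n.cast_nonneg (α := ℝ)
        have := hτ1 n
        exact mul_nonneg ((hS _ (hγ n).1).p_pos (hlt n)).le (by linarith)
      energy := tendsto_iff_dist_tendsto_zero.2
        (squeeze_zero (fun _ => dist_nonneg) (fun n => by rw [Real.dist_eq]; exact hA n) hlim) }
  obtain ⟨n, hn⟩ := (Metric.tendsto_nhds.1 H.tendsto_energy ε hε).exists
  exact (hγ n).2 hn

lemma IsGSol.radialSol {a c0 β γ : ℝ} {g u : ℝ → ℝ} (hu : IsGSol g β γ u) (hG : GCtx a c0 g)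
    (hβ : 0 < β) : RadialSol g β u :=
  ⟨hβ, hG.2.2.1, hG.2.2.2.1, hu.1, hu.2.1, hu.2.2.1, hu.2.2.2.1⟩

lemma EigenCtx.radialSol {lam1 : ℝ} {v1 : ℝ → ℝ} (hE : EigenCtx lam1 v1) :
    RadialSol (fun _ => 1) lam1 v1 :=
  ⟨hE.1, continuousOn_const, fun _ _ => one_pos, hE.2.1,
    fun r hr => by rw [hE.2.2.1 r hr, mul_one], hE.2.2.2.1, hE.2.2.2.2.1⟩

lemma EigenCtx.integral_density {lam1 : ℝ} {v1 : ℝ → ℝ} (hE : EigenCtx lam1 v1) :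
    ∫ t in (0 : ℝ)..1, RadialSol.density (fun _ => 1) lam1 v1 t = lam1 / (2 * π) := by
  have h : ∀ t, RadialSol.density (fun _ => 1) lam1 v1 t =
      lam1 / (2 * π) * (v1 t ^ 2 * (2 * π * t)) := fun t => by
    rw [RadialSol.density]
    field_simp
  simp_rw [h]
  rw [intervalIntegral.integral_const_mul, intervalIntegral.integral_of_le zero_le_one,
    integral_Ioc_eq_integral_Ioo, hE.2.2.2.2.2, mul_one]

/-- Assume in addition g(t) = 1 for t ∈ [0, a/2]. Then β_{a/2} = λ₁ and
u_{a/2} = (a/(2v₁(0))) v₁, and consequently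
∫_Ω |∇u_γ|² dy → 4π + a²λ₁/(4v₁(0)²) as γ → +∞. -/
theorem statement19 (lam1 : ℝ) (v1 : ℝ → ℝ) (hE : EigenCtx lam1 v1)
    (a c0 : ℝ) (g : ℝ → ℝ) (hG : GCtx a c0 g)
    (hg1 : ∀ t ∈ Set.Icc (0:ℝ) (a / 2), g t = 1)
    (β : ℝ → ℝ) (u : ℝ → ℝ → ℝ)
    (hsol : ∀ γ : ℝ, 0 < γ → 0 < β γ ∧ IsGSol g (β γ) γ (u γ))
    (βh : ℝ) (uh : ℝ → ℝ) (hh : 0 < βh ∧ IsGSol g βh (a / 2) uh) :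
    βh = lam1 ∧
    Set.EqOn uh (fun r => a / (2 * v1 0) * v1 r) (Set.Icc 0 1) ∧
    Tendsto (fun γ : ℝ => dirEnergy (u γ)) atTop
      (𝓝 (4 * π + a ^ 2 * lam1 / (4 * (v1 0) ^ 2))) := by
  have T := hE.radialSol.logSol
  rw [hE.integral_density] at T
  have hψ := T.top_pos
  have hS := (hh.2.radialSol hG hh.1).logSol
  have hu0 : uh 0 = a / 2 := hh.2.2.2.2.2
  rw [hu0] at hS
  obtain ⟨hs, hW⟩ := hS.eq_of_linear T hg1
  have hβ : βh = lam1 := log_injOn_pos hh.1 hE.1 (by linarith)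
  refine ⟨hβ, fun r hr => ?_, ?_⟩
  · change uh r = a / (2 * v1 0) * v1 r
    rcases hr.1.eq_or_lt with h0 | h0
    · rw [← h0, hu0]
      field_simp
    rcases hr.2.eq_or_lt with h1 | h1
    · rw [h1, hh.2.2.2.2.1, hE.2.2.2.2.1, mul_zero]
    have h2 := hW (-log βh / 2 - log r) (by have := log_neg h0 h1; linarith)
    rw [hβ, sub_sub_cancel, exp_log h0] at h2
    rw [h2, div_div]
  · have hlim := tendsto_energy_of_logSol hG hg1 (fun γ hγ => by
      have := ((hsol γ hγ).2.radialSol hG (hsol γ hγ).1).logSol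
      rw [show u γ 0 = γ from (hsol γ hγ).2.2.2.2.2] at this
      exact this) T
    have h2 := hlim.const_mul (2 * π)
    have e : 2 * π * (2 + (a / 2 / v1 0) ^ 2 * (lam1 / (2 * π))) =
        4 * π + a ^ 2 * lam1 / (4 * v1 0 ^ 2) := by
      field_simp
      ring
    rw [e] at h2
    refine h2.congr' ?_
    filter_upwards [eventually_gt_atTop 0] with γ hγ
    exact (((hsol γ hγ).2.radialSol hG (hsol γ hγ).1).dirEnergy_eq).symm

end
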